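/- For every field k and every finite group Γ, there exists a Galois field extension M of K = k((x,t)) with Galois group isomorphic to Γ. -/

import Mathlib

/-- `k[[x,t]]` is a domain. -/
instance (k : Type) [Field k] : IsDomain (MvPowerSeries (Fin 2) k) :=
  NoZeroDivisors.to_isDomain _

/-- The two-variable Laurent field `k((x,t))`, i.e. the fraction field of `k[[x,t]]`. -/
abbrev TwoVarLocalField (k : Type) [Field k] : Type :=
  FractionRing (MvPowerSeries (Fin 2) k)

/-! ### Abstract patching -/

section Patching

variable {K Ω G : Type} [Field K] [Field Ω] [Algebra K Ω] [Group G] {ι : Type}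

/-- The functions `a : G → Ω` whose restriction to every left coset of `H` is a `P`-linear
combination of the translates of `β`. -/
def IsPatchable (H : Subgroup G) [Fintype H] (P : Subalgebra K Ω) (β : H → Ω) (a : G → Ω) : Prop :=
  ∀ θ : G, ∃ p : H → Ω, (∀ h, p h ∈ P) ∧ ∀ τ : H, a (θ * τ) = ∑ h, p h * β (h * τ)

/-- The `K`-algebra of functions `G → Ω` satisfying all patching conditions. -/
def patchedAlgebra (H : ι → Subgroup G) [∀ i, Fintype (H i)] (P : ι → Subalgebra K Ω)
    (β : ∀ i, H i → Ω)
    (hmul : ∀ i, ∃ c : H i → H i → H i → K, ∀ a b τ,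
      β i (a * τ) * β i (b * τ) = ∑ h, c a b h • β i (h * τ))
    (hsum : ∀ i, ∃ e : K, e • ∑ h, β i h = 1) : Subalgebra K (G → Ω) where
  carrier := {a | ∀ i, IsPatchable (H i) (P i) (β i) a}
  mul_mem' := by
    intro a b ha hb i θ
    obtain ⟨p, hp, hpa⟩ := ha i θ
    obtain ⟨q, hq, hqb⟩ := hb i θ
    obtain ⟨c, hc⟩ := hmul i
    refine ⟨fun h => ∑ x, ∑ y, p x * q y * algebraMap K Ω (c x y h), fun h => ?_, fun τ => ?_⟩
    · exact Subalgebra.sum_mem _ fun x _ => Subalgebra.sum_mem _ fun y _ =>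
        mul_mem (mul_mem (hp x) (hq y)) (Subalgebra.algebraMap_mem _ _)
    · rw [Pi.mul_apply, hpa, hqb, Finset.sum_mul_sum]
      simp_rw [Finset.sum_mul]
      rw [Finset.sum_comm' (t' := Finset.univ) (s' := fun _ => Finset.univ) (by simp)]
      conv_rhs => rw [Finset.sum_comm]
      rw [Finset.sum_comm]
      refine Finset.sum_congr rfl fun x _ => ?_
      conv_rhs => rw [Finset.sum_comm]
      refine Finset.sum_congr rfl fun y _ => ?_
      rw [show p x * β i (x * τ) * (q y * β i (y * τ))
        = p x * q y * (β i (x * τ) * β i (y * τ)) by ring, hc, Finset.mul_sum]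
      refine Finset.sum_congr rfl fun h _ => ?_
      rw [Algebra.smul_def]; ring
  add_mem' := by
    intro a b ha hb i θ
    obtain ⟨p, hp, hpa⟩ := ha i θ
    obtain ⟨q, hq, hqb⟩ := hb i θ
    refine ⟨p + q, fun h => add_mem (hp h) (hq h), fun τ => ?_⟩
    rw [Pi.add_apply, hpa, hqb, ← Finset.sum_add_distrib]
    exact Finset.sum_congr rfl fun h _ => by rw [Pi.add_apply]; ring
  algebraMap_mem' := by
    intro r i θ
    obtain ⟨e, he⟩ := hsum i
    refine ⟨fun _ => algebraMap K Ω (r * e), fun h => Subalgebra.algebraMap_mem _ _, fun τ => ?_⟩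
    rw [← Finset.mul_sum, Fintype.sum_equiv (Equiv.mulRight τ) (fun h => β i (h * τ)) (β i)
      (fun _ => rfl),
      map_mul, mul_assoc, ← Algebra.smul_def e, he, mul_one]
    rfl

variable (H : ι → Subgroup G) [∀ i, Fintype (H i)] (P : ι → Subalgebra K Ω)
    (β : ∀ i, H i → Ω)
    (hmul : ∀ i, ∃ c : H i → H i → H i → K, ∀ a b τ,
      β i (a * τ) * β i (b * τ) = ∑ h, c a b h • β i (h * τ))
    (hsum : ∀ i, ∃ e : K, e • ∑ h, β i h = 1)

instance patchedAlgebra.mulSemiringAction :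
    MulSemiringAction G (patchedAlgebra H P β hmul hsum) where
  smul g a := ⟨fun θ => a.1 (g⁻¹ * θ), fun i θ => by
    obtain ⟨p, hp, h⟩ := a.2 i (g⁻¹ * θ)
    exact ⟨p, hp, fun τ => by rw [← h, mul_assoc]⟩⟩
  one_smul a := Subtype.ext <| funext fun θ => by
    change a.1 (1⁻¹ * θ) = _
    simp
  mul_smul g g' a := Subtype.ext <| funext fun θ => by
    change a.1 ((g * g')⁻¹ * θ) = a.1 (g'⁻¹ * (g⁻¹ * θ))
    simp [mul_assoc]
  smul_zero _ := rfl
  smul_add _ _ _ := rfl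
  smul_one _ := rfl
  smul_mul _ _ _ := rfl

theorem patchedAlgebra.smul_apply (g : G) (a : patchedAlgebra H P β hmul hsum) (θ : G) :
    (g • a).1 θ = a.1 (g⁻¹ * θ) := rfl

theorem patchedAlgebra.eq_zero_of_apply_eq_zero (hH : ⨆ i, H i = ⊤)
    (hind : ∀ i, ∀ p : H i → Ω, (∀ h, p h ∈ P i) → ∑ h, p h * β i h = 0 → ∀ h, p h = 0)
    (a : patchedAlgebra H P β hmul hsum) (θ : G) (h0 : a.1 θ = 0) : a = 0 := by
  have key : ∀ g : G, ∀ θ, a.1 θ = 0 → a.1 (θ * g) = 0 := by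
    intro g
    have hg : g ∈ ⨆ i, H i := hH ▸ Subgroup.mem_top g
    refine Subgroup.iSup_induction H (C := fun g => ∀ θ, a.1 θ = 0 → a.1 (θ * g) = 0) hg
      (fun i g hg => ?_) (by simp) (fun x y hx hy => ?_)
    · intro θ h0
      obtain ⟨p, hp, h⟩ := a.2 i θ
      have h1 := h 1
      simp only [OneMemClass.coe_one, mul_one, h0] at h1
      have h2 := h ⟨g, hg⟩
      simpa [hind i p hp h1.symm] using h2
    · intro θ h0
      rw [← mul_assoc]
      exact hy _ (hx _ h0)
  refine Subtype.ext <| funext fun x => ?_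
  simpa using key (θ⁻¹ * x) θ h0

/-- Functions satisfying the patching conditions form a Galois extension with group `G`. -/
theorem exists_isGaloisGroup_of_patching [Finite G] [Nonempty ι] (hH : ⨆ i, H i = ⊤)
    (hind : ∀ i, ∀ p : H i → Ω, (∀ h, p h ∈ P i) → ∑ h, p h * β i h = 0 → ∀ h, p h = 0)
    (hP : ⨅ i, P i = ⊥)
    (hmul : ∀ i, ∃ c : H i → H i → H i → K, ∀ a b τ,
      β i (a * τ) * β i (b * τ) = ∑ h, c a b h • β i (h * τ))
    (hsum : ∀ i, ∃ e : K, e • ∑ h, β i h = 1)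
    (v : G → Ω) (hv : ∀ i, IsPatchable (H i) (P i) (β i) v) (hv1 : ∀ θ ≠ 1, v θ ≠ v 1) :
    ∃ (F : Type) (_ : Field F) (_ : Algebra K F) (_ : MulSemiringAction G F),
      IsGaloisGroup G K F := by
  let A := patchedAlgebra H P β hmul hsum
  have inj : Function.Injective ((Pi.evalAlgHom K (fun _ : G => Ω) 1).comp A.val) := by
    rw [injective_iff_map_eq_zero]
    intro a ha
    exact patchedAlgebra.eq_zero_of_apply_eq_zero H P β hmul hsum hH hind a 1 ha
  have : IsDomain A := inj.isDomain _
  have hG : IsGaloisGroup G K A := by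
    refine ⟨⟨fun {g g'} h => ?_⟩, ⟨fun g r a => rfl⟩, ⟨fun a ha => ?_⟩⟩
    · by_contra hne
      have h1 := congrArg (fun a : A => a.1 g) (h ⟨v, hv⟩)
      change v (g⁻¹ * g) = v (g'⁻¹ * g) at h1
      rw [inv_mul_cancel] at h1
      exact hv1 (g'⁻¹ * g) (fun h2 => hne (inv_mul_eq_one.mp h2).symm) h1.symm
    · have hconst : ∀ θ, a.1 θ = a.1 1 := fun θ => by
        conv_rhs => rw [← ha θ⁻¹, patchedAlgebra.smul_apply, inv_inv, mul_one]
      have hmem : a.1 1 ∈ ⨅ i, P i := by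
        rw [Algebra.mem_iInf]
        intro i
        obtain ⟨p, hp, h⟩ := a.2 i 1
        obtain ⟨e, he⟩ := hsum i
        have hpc : ∀ τ g : H i, p (g * τ⁻¹) - p g = 0 := by
          intro τ
          refine hind i _ (fun g => sub_mem (hp _) (hp _)) ?_
          simp_rw [sub_mul]
          rw [Finset.sum_sub_distrib, ← Fintype.sum_equiv (Equiv.mulRight τ)
            (fun g => p g * β i (g * τ)) (fun g => p (g * τ⁻¹) * β i g) (by simp), ← h]
          have := h 1
          simp only [OneMemClass.coe_one, mul_one] at this
          rw [← this, hconst, sub_self]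
        have hpe : ∀ g, p g = p 1 := fun g => by
          have := hpc g g
          rw [mul_inv_cancel] at this
          exact (sub_eq_zero.mp this).symm
        have h1 := h 1
        simp only [OneMemClass.coe_one, mul_one, hpe, ← Finset.mul_sum] at h1
        have h2 : p 1 = e • a.1 1 := by
          rw [h1, ← mul_smul_comm, he, mul_one]
        have he0 : e ≠ 0 := by
          rintro rfl
          simp at he
        rw [show a.1 1 = e⁻¹ • p 1 by rw [h2, smul_smul, inv_mul_cancel₀ he0, one_smul]]
        exact Subalgebra.smul_mem _ (hp 1) _
      rw [hP, Algebra.mem_bot] at hmem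
      obtain ⟨r, hr⟩ := hmem
      refine ⟨r, Subtype.ext <| funext fun θ => ?_⟩
      rw [hconst θ, ← hr]
      rfl
  have : Algebra.IsIntegral K A := hG.isInvariant.isIntegral K A G
  have hF : IsField A := isField_of_isIntegral_of_isField' (Field.toIsField K)
  let _ : Field A := hF.toField
  exact ⟨A, inferInstance, inferInstance, inferInstance, hG⟩

end Patching

theorem exists_intermediateField_of_isGaloisGroup {K F G : Type} [Field K] [Field F] [Algebra K F]
    [Group G] [Finite G] [MulSemiringAction G F] [IsGaloisGroup G K F] :
    ∃ M : IntermediateField K (AlgebraicClosure K),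
      FiniteDimensional K M ∧ IsGalois K M ∧ Nonempty ((M ≃ₐ[K] M) ≃* G) := by
  have := IsGaloisGroup.isGalois G K F
  have := IsGaloisGroup.finiteDimensional G K F
  let f : F →ₐ[K] AlgebraicClosure K := IsAlgClosed.lift
  let e : F ≃ₐ[K] f.fieldRange := AlgEquiv.ofInjectiveField f
  exact ⟨f.fieldRange, Module.Finite.equiv e.toLinearEquiv, IsGalois.of_algEquiv e,
    ⟨(AlgEquiv.autCongr e.symm).trans (IsGaloisGroup.mulEquivAlgEquiv G K F).symm⟩⟩

/-! ### Patching over fraction fields -/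

theorem algebraMap_ne_zero_of_fractionRing {R Ω : Type} (K : Type) [CommRing R] [Field K] [Field Ω]
    [Algebra R K] [IsFractionRing R K] [Algebra R Ω] [Algebra K Ω] [IsScalarTower R K Ω] {d : R}
    (hd : d ≠ 0) : algebraMap R Ω d ≠ 0 := by
  rw [IsScalarTower.algebraMap_apply R K Ω]
  simpa using hd

section FractionFieldPatching

variable {R Q K Ω G : Type} [CommRing R] [IsDomain R] [CommRing Q] [Algebra R Q]
  [Field K] [Field Ω] [Algebra R K] [IsFractionRing R K] [Algebra Q Ω]
  [IsFractionRing Q Ω] [Algebra R Ω] [Algebra K Ω] [IsScalarTower R K Ω] [IsScalarTower R Q Ω]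
  [Group G] {ι : Type}

/-- The fractions `f / d` with `f ∈ P` and nonzero `d ∈ R`. -/
def Subalgebra.fractions (P : Subalgebra R Q) (K Ω : Type) [Field K] [Field Ω] [Algebra R K]
    [IsFractionRing R K] [Algebra Q Ω] [IsFractionRing Q Ω] [Algebra R Ω] [Algebra K Ω]
    [IsScalarTower R K Ω] [IsScalarTower R Q Ω] : Subalgebra K Ω where
  carrier := {ω | ∃ d : R, d ≠ 0 ∧ ∃ f ∈ P, algebraMap R Ω d * ω = algebraMap Q Ω f}
  mul_mem' := by
    rintro a b ⟨d, hd, f, hf, h⟩ ⟨d', hd', f', hf', h'⟩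
    refine ⟨d * d', mul_ne_zero hd hd', f * f', mul_mem hf hf', ?_⟩
    rw [map_mul, map_mul, ← h, ← h']; ring
  add_mem' := by
    rintro a b ⟨d, hd, f, hf, h⟩ ⟨d', hd', f', hf', h'⟩
    refine ⟨d * d', mul_ne_zero hd hd', d' • f + d • f',
      add_mem (P.smul_mem hf _) (P.smul_mem hf' _), ?_⟩
    rw [map_mul, map_add, Algebra.smul_def, Algebra.smul_def, map_mul, map_mul, ← h, ← h',
      ← IsScalarTower.algebraMap_apply, ← IsScalarTower.algebraMap_apply]
    ring
  algebraMap_mem' := by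
    intro r
    obtain ⟨a, d, hd, rfl⟩ := IsFractionRing.div_surjective (A := R) r
    have hd0 : d ≠ 0 := nonZeroDivisors.ne_zero hd
    refine ⟨d, hd0, algebraMap R Q a, P.algebraMap_mem a, ?_⟩
    rw [← IsScalarTower.algebraMap_apply, IsScalarTower.algebraMap_apply R K Ω,
      IsScalarTower.algebraMap_apply R K Ω, ← map_mul, mul_div_cancel₀]
    simpa using hd0

theorem Subalgebra.algebraMap_mem_fractions (P : Subalgebra R Q) {f : Q} (hf : f ∈ P) :
    algebraMap Q Ω f ∈ P.fractions K Ω :=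
  ⟨1, one_ne_zero, f, hf, by simp⟩

theorem Subalgebra.iInf_fractions [Finite ι] [Nonempty ι] (P : ι → Subalgebra R Q)
    (hP : ⨅ i, P i = ⊥) : ⨅ i, (P i).fractions K Ω = ⊥ := by
  rw [eq_bot_iff]
  intro ω hω
  have := Fintype.ofFinite ι
  rw [Algebra.mem_iInf] at hω
  choose d hd f hf h using hω
  have hD : ∏ i, d i ≠ 0 := Finset.prod_ne_zero_iff.mpr fun i _ => hd i
  classical
  have key : ∀ i, algebraMap R Ω (∏ i, d i) * ω
      = algebraMap Q Ω ((∏ j ∈ Finset.univ.erase i, d j) • f i) := fun i => by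
    rw [← Finset.mul_prod_erase _ _ (Finset.mem_univ i), Algebra.smul_def, map_mul, map_mul,
      ← h i, ← IsScalarTower.algebraMap_apply]
    ring
  obtain ⟨i₀⟩ := ‹Nonempty ι›
  have hmem : (∏ j ∈ Finset.univ.erase i₀, d j) • f i₀ ∈ ⨅ i, P i := by
    rw [Algebra.mem_iInf]
    intro i
    rw [IsFractionRing.injective Q Ω ((key i₀).symm.trans (key i))]
    exact (P i).smul_mem (hf i) _
  rw [hP, Algebra.mem_bot] at hmem
  obtain ⟨r, hr⟩ := hmem
  rw [Algebra.mem_bot]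
  refine ⟨algebraMap R K r / algebraMap R K (∏ i, d i), ?_⟩
  rw [map_div₀, ← IsScalarTower.algebraMap_apply, ← IsScalarTower.algebraMap_apply,
    div_eq_iff (algebraMap_ne_zero_of_fractionRing K hD), mul_comm, key i₀, ← hr,
    ← IsScalarTower.algebraMap_apply]

theorem exists_isGaloisGroup_of_fractions [Finite G] [Finite ι] [Nonempty ι]
    (H : ι → Subgroup G) [∀ i, Fintype (H i)] (hH : ⨆ i, H i = ⊤)
    (P : ι → Subalgebra R Q) (hP : ⨅ i, P i = ⊥) (β : ∀ i, H i → Q)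
    (hind : ∀ i, ∀ p : H i → Q, (∀ h, p h ∈ P i) → ∑ h, p h * β i h = 0 → ∀ h, p h = 0)
    (hmul : ∀ i, ∃ c : H i → H i → H i → K, ∀ a b τ,
      algebraMap Q Ω (β i (a * τ)) * algebraMap Q Ω (β i (b * τ))
        = ∑ h, c a b h • algebraMap Q Ω (β i (h * τ)))
    (hsum : ∀ i, ∃ e : K, e • ∑ h, algebraMap Q Ω (β i h) = 1)
    (v : G → Q) (q : ι → G → Q) (hq : ∀ i θ, q i θ ∈ P i)
    (hv : ∀ i θ, v θ = ∑ h : H i, q i (θ * (h : G)⁻¹) * β i h) (hv1 : ∀ θ ≠ 1, v θ ≠ v 1) :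
    ∃ (F : Type) (_ : Field F) (_ : Algebra K F) (_ : MulSemiringAction G F),
      IsGaloisGroup G K F := by
  refine exists_isGaloisGroup_of_patching H (fun i => (P i).fractions K Ω)
    (fun i h => algebraMap Q Ω (β i h)) hH ?_ (Subalgebra.iInf_fractions P hP) hmul hsum
    (fun θ => algebraMap Q Ω (v θ)) ?_ fun θ hθ h => hv1 θ hθ (IsFractionRing.injective Q Ω h)
  · intro i p hp h0 h
    choose d hd f hf hdf using hp
    classical
    have hD : ∏ h, d h ≠ 0 := Finset.prod_ne_zero_iff.mpr fun i _ => hd i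
    have key : ∀ h, algebraMap R Ω (∏ h, d h) * p h
        = algebraMap Q Ω ((∏ j ∈ Finset.univ.erase h, d j) • f h) := fun h => by
      rw [← Finset.mul_prod_erase _ _ (Finset.mem_univ h), Algebra.smul_def, map_mul, map_mul,
        ← hdf h, ← IsScalarTower.algebraMap_apply]
      ring
    have h1 := hind i (fun h => (∏ j ∈ Finset.univ.erase h, d j) • f h)
      (fun h => (P i).smul_mem (hf h) _) (by
        apply IsFractionRing.injective Q Ω
        rw [map_sum, map_zero]
        simp_rw [map_mul, ← key, mul_assoc]
        rw [← Finset.mul_sum, h0, mul_zero]) h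
    have h2 := key h
    rw [h1, map_zero] at h2
    exact (mul_eq_zero.mp h2).resolve_left (algebraMap_ne_zero_of_fractionRing K hD)
  · intro i θ
    refine ⟨fun h => algebraMap Q Ω (q i (θ * (h : G)⁻¹)),
      fun h => Subalgebra.algebraMap_mem_fractions _ (hq i _), fun τ => ?_⟩
    change algebraMap Q Ω (v (θ * τ)) = _
    rw [hv i, map_sum]
    refine (Fintype.sum_equiv (Equiv.mulRight τ) _ _ fun h => ?_).symm
    simp [mul_assoc]

end FractionFieldPatching

/-! ### Split torsors over the projective line -/

section SplitTorsor

open Polynomial PowerSeries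

/-- A family of power series indexed by a finite group `H` that behaves like the conjugates of a
normal basis generator of a function field over `k(X)` with group `H` in which `X = 0` splits
completely. -/
structure IsSplitTorsor {k H : Type} [Field k] [Group H] [Fintype H] (β : H → k⟦X⟧) : Prop where
  one : constantCoeff (β 1) = 1
  ne : ∀ h ≠ 1, constantCoeff (β h) = 0
  indep : ∀ p : H → k[X], ∑ h, (p h : k⟦X⟧) * β h = 0 → ∀ h, p h = 0
  mul : ∃ d : k[X], d ≠ 0 ∧ ∃ c : H → H → H → k[X], ∀ a b τ,
    (d : k⟦X⟧) * (β (a * τ) * β (b * τ)) = ∑ h, (c a b h : k⟦X⟧) * β (h * τ)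
  sum : ∃ d e : k[X], d ≠ 0 ∧ (e : k⟦X⟧) * ∑ h, β h = d

theorem IsSplitTorsor.comp_mulEquiv {k H H' : Type} [Field k] [Group H] [Fintype H] [Group H']
    [Fintype H'] {β : H → k⟦X⟧} (hβ : IsSplitTorsor β) (e : H' ≃* H) : IsSplitTorsor (β ∘ e) where
  one := by simpa using hβ.one
  ne h hh := hβ.ne _ (by simpa using hh)
  indep p hp h := by
    have := hβ.indep (fun h => p (e.symm h)) (by
      rw [← hp, ← e.toEquiv.sum_comp]
      simp) (e h)
    simpa using this
  mul := by
    obtain ⟨d, hd, c, hc⟩ := hβ.mul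
    refine ⟨d, hd, fun a b h => c (e a) (e b) (e h), fun a b τ => ?_⟩
    simp only [Function.comp_apply, map_mul]
    rw [hc, ← e.toEquiv.sum_comp]
    simp
  sum := by
    obtain ⟨d, c, hd, hc⟩ := hβ.sum
    refine ⟨d, c, hd, ?_⟩
    rw [← hc, ← e.toEquiv.sum_comp]
    simp

theorem isSplitTorsor_one {k H : Type} [Field k] [Group H] [Fintype H] [Subsingleton H] :
    IsSplitTorsor (fun _ : H => (1 : k⟦X⟧)) where
  one := by simp
  ne h hh := absurd (Subsingleton.elim _ _) hh
  indep p hp h := by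
    have := Subsingleton.elim h 1
    subst this
    simpa [Fintype.sum_subsingleton _ (1 : H)] using hp
  mul := ⟨1, one_ne_zero, fun _ _ _ => 1, fun a b τ => by simp [Fintype.sum_subsingleton _ (1 : H)]⟩
  sum := ⟨1, 1, one_ne_zero, by simp [Fintype.sum_subsingleton _ (1 : H)]⟩

theorem IsSplitTorsor.of_zmod {k : Type} [Field k] {n : ℕ} [NeZero n] (β : ZMod n → k⟦X⟧)
    (hconst : ∀ i, constantCoeff (β i) = if i = 0 then 1 else 0)
    (hindep : ∀ p : ZMod n → k[X], ∑ i, (p i : k⟦X⟧) * β i = 0 → ∀ i, p i = 0)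
    (hmul : ∃ d : k[X], d ≠ 0 ∧ ∃ c : ZMod n → ZMod n → ZMod n → k[X], ∀ a b τ,
      (d : k⟦X⟧) * (β (a + τ) * β (b + τ)) = ∑ h, (c a b h : k⟦X⟧) * β (h + τ))
    (hsum : ∑ i, β i = 1) :
    IsSplitTorsor (fun h : Multiplicative (ZMod n) => β h.toAdd) where
  one := by simp [hconst]
  ne h hh := by simp [hconst, hh]
  indep p hp h := hindep (fun i => p (.ofAdd i)) (by
    rw [← hp]
    exact Fintype.sum_equiv Multiplicative.ofAdd _ _ fun _ => rfl) h.toAdd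
  mul := by
    obtain ⟨d, hd, c, hc⟩ := hmul
    refine ⟨d, hd, fun a b h => c a.toAdd b.toAdd h.toAdd, fun a b τ => ?_⟩
    refine (hc a.toAdd b.toAdd τ.toAdd).trans ?_
    exact Fintype.sum_equiv Multiplicative.ofAdd _ _ fun _ => rfl
  sum := ⟨1, 1, one_ne_zero, by
    rw [Polynomial.coe_one, one_mul, ← hsum]
    exact Fintype.sum_equiv Multiplicative.toAdd _ _ fun _ => rfl⟩

/-- Hensel's lemma for power series over a field. -/
theorem PowerSeries.exists_isRoot_of_simple {k : Type} [Field k] (f : k⟦X⟧[X]) (hf : f.Monic)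
    (a : k⟦X⟧) (h0 : constantCoeff (f.eval a) = 0)
    (h1 : constantCoeff (f.derivative.eval a) ≠ 0) :
    ∃ y, f.eval y = 0 ∧ constantCoeff y = constantCoeff a := by
  obtain ⟨y, hy, hya⟩ := HenselianRing.is_henselian (I := Ideal.span {(X : k⟦X⟧)}) f hf a
    (by rwa [Ideal.mem_span_singleton, X_dvd_iff])
    (IsUnit.map _ (isUnit_iff_constantCoeff.mpr (isUnit_iff_ne_zero.mpr h1)))
  refine ⟨y, hy, ?_⟩
  rwa [Ideal.mem_span_singleton, X_dvd_iff, map_sub, sub_eq_zero] at hya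

theorem PowerSeries.exists_pow_eq_one_add_X {k : Type} [Field k] (n : ℕ) (hn : (n : k) ≠ 0) :
    ∃ u : k⟦X⟧, u ^ n = 1 + X ∧ constantCoeff u = 1 := by
  have hn0 : n ≠ 0 := by rintro rfl; simp at hn
  obtain ⟨u, hu, hu1⟩ := exists_isRoot_of_simple
    (Polynomial.X ^ n - Polynomial.C (1 + X : k⟦X⟧)) (monic_X_pow_sub_C _ hn0) 1 (by simp)
    (by simpa [derivative_X_pow] using hn)
  refine ⟨u, ?_, by simpa using hu1⟩
  simpa [sub_eq_zero] using hu

end SplitTorsor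

/-! ### Artin–Schreier extensions -/

section ArtinSchreier

open Polynomial

theorem Polynomial.monic_X_pow_sub_X_sub_C {F : Type} [CommRing F] [Nontrivial F] {p : ℕ}
    (hp : 1 < p) (a : F) : (X ^ p - X - C a).Monic ∧ (X ^ p - X - C a).natDegree = p := by
  have h : (X ^ p - X - C a) = X ^ p - (X + C a) := by ring
  have hd : (X + C a).degree < (p : WithBot ℕ) := by
    rw [degree_X_add_C]
    exact_mod_cast hp
  rw [h]
  refine ⟨monic_X_pow_sub hd, ?_⟩
  rw [natDegree_sub_eq_left_of_natDegree_lt] <;> simp [hp]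

/-- An Artin–Schreier polynomial without roots is irreducible. -/
theorem Polynomial.irreducible_X_pow_sub_X_sub_C {F : Type} [Field F] {p : ℕ} [Fact p.Prime]
    [CharP F p] (a : F) (ha : ∀ r : F, r ^ p - r ≠ a) : Irreducible (X ^ p - X - C a) := by
  have hp := (Fact.out : p.Prime)
  obtain ⟨hmonic, hdeg⟩ := monic_X_pow_sub_X_sub_C hp.one_lt a
  have hne : (X ^ p - X - C a) ≠ 1 := by
    intro h
    rw [h, natDegree_one] at hdeg
    exact hp.ne_zero hdeg.symm
  rw [hmonic.irreducible_iff_lt_natDegree_lt hne, hdeg]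
  intro g hg hgd hdvd
  rw [Finset.mem_Ioc] at hgd
  let Ω := AlgebraicClosure F
  have : CharP Ω p := charP_of_injective_algebraMap (algebraMap F Ω).injective p
  have hsplit : (g.map (algebraMap F Ω)).Splits := IsAlgClosed.splits _
  have hroot : ∀ r ∈ (g.map (algebraMap F Ω)).roots, r ^ p = r + algebraMap F Ω a := by
    intro r hr
    have h1 := eval_dvd (x := r) (_root_.map_dvd (mapRingHom (algebraMap F Ω)) hdvd)
    have h2 : (g.map (algebraMap F Ω)).eval r = 0 := isRoot_of_mem_roots hr
    rw [coe_mapRingHom, h2, zero_dvd_iff] at h1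
    simp only [Polynomial.map_sub, Polynomial.map_pow, map_X, map_C, eval_sub, eval_pow, eval_X,
      eval_C] at h1
    linear_combination h1
  have hsum := hsplit.nextCoeff_eq_neg_sum_roots_of_monic (hg.map _)
  rw [nextCoeff_map (algebraMap F Ω).injective] at hsum
  have hcard : (Multiset.card (g.map (algebraMap F Ω)).roots) = g.natDegree := by
    rw [← hsplit.natDegree_eq_card_roots, natDegree_map]
  have hpow : (-g.nextCoeff) ^ p = -g.nextCoeff + g.natDegree * a := by
    apply (algebraMap F Ω).injective
    have h1 : algebraMap F Ω (-g.nextCoeff) = (g.map (algebraMap F Ω)).roots.sum := by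
      rw [map_neg, hsum, neg_neg]
    rw [map_pow, map_add, h1, multiset_sum_pow_char, Multiset.map_congr rfl hroot,
      Multiset.sum_map_add, Multiset.map_id', Multiset.map_const', Multiset.sum_replicate, hcard]
    simp
  have hd : (g.natDegree : F) ≠ 0 := by
    rw [Ne, CharP.cast_eq_zero_iff F p]
    intro h
    have h1 := Nat.le_of_dvd hgd.1 h
    have h2 := Nat.div_lt_self hp.pos one_lt_two
    omega
  have hdp : (g.natDegree : F) ^ p = g.natDegree := by
    rw [← frobenius_def, map_natCast]
  refine ha (-g.nextCoeff / g.natDegree) ?_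
  rw [div_pow, hdp, hpow]
  field_simp
  ring

theorem sum_add_natCast_pow_sub_one {R : Type} [CommRing R] {p : ℕ} [Fact p.Prime] [CharP R p]
    (y : R) : ∑ i ∈ Finset.range p, (y + i) ^ (p - 1) = -1 := by
  have hp := (Fact.out : p.Prime)
  have hrange (m : ℕ) : ∑ i ∈ Finset.range p, (i : R) ^ m
      = ZMod.castHom dvd_rfl R (∑ z : ZMod p, z ^ m) := by
    rw [map_sum]
    refine Finset.sum_bij' (fun i _ => (i : ZMod p)) (fun z _ => z.val) (by simp)
      (fun z _ => by simpa using z.val_lt) (fun i hi => ZMod.val_cast_of_lt (by simpa using hi))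
      (fun z _ => by simp) fun i _ => by simp
  have htop : ∑ z : ZMod p, z ^ (p - 1) = -1 := by
    have h : ∀ z : ZMod p, z ^ (p - 1) = 1 - if z = 0 then 1 else 0 := fun z => by
      split_ifs with hz
      · rw [hz, zero_pow (by have := hp.two_le; omega), sub_self]
      · rw [ZMod.pow_card_sub_one_eq_one hz, sub_zero]
    simp [h]
  simp_rw [add_pow]
  rw [Finset.sum_comm]
  simp_rw [mul_right_comm _ _ (Nat.choose _ _ : R), ← Finset.mul_sum, hrange]
  rw [Finset.sum_eq_single 0]
  · simp [htop]
  · intro m hm hm0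
    rw [FiniteField.sum_pow_lt_card_sub_one, map_zero, mul_zero]
    rw [ZMod.card]
    have := Finset.mem_range.mp hm
    omega
  · simp

theorem additive_hilbert_ninety {E F : Type} [Field E] [Field F] [Algebra E F] (σ : F →ₐ[E] F)
    {n : ℕ} (hσ : σ ^ n = 1) {b x : F} (hb : ∑ i ∈ Finset.range n, (σ ^ i) b = 1)
    (hx : ∑ i ∈ Finset.range n, (σ ^ i) x = 0) :
    σ (-∑ i ∈ Finset.range n, (∑ l ∈ Finset.range i, (σ ^ l) x) * (σ ^ i) b)
      = -∑ i ∈ Finset.range n, (∑ l ∈ Finset.range i, (σ ^ l) x) * (σ ^ i) b + x := by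
  have hs (i : ℕ) (a : F) : σ ((σ ^ i) a) = (σ ^ (i + 1)) a := by
    rw [pow_succ', AlgHom.mul_apply]
  have hσS (i : ℕ) : σ (∑ l ∈ Finset.range i, (σ ^ l) x)
      = ∑ l ∈ Finset.range (i + 1), (σ ^ l) x - x := by
    rw [Finset.sum_range_succ', map_sum]
    simp_rw [hs]
    rw [pow_zero, AlgHom.one_apply, add_sub_cancel_right]
  have hshift (f : ℕ → F) (h : f n = f 0) :
      ∑ i ∈ Finset.range n, f (i + 1) = ∑ i ∈ Finset.range n, f i := by
    have := (Finset.sum_range_succ f n).symm.trans (Finset.sum_range_succ' f n)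
    rw [h] at this
    exact (add_right_cancel this).symm
  have h1 := hshift (fun i => (∑ l ∈ Finset.range i, (σ ^ l) x) * (σ ^ i) b) (by
    rw [hx, zero_mul, Finset.range_zero, Finset.sum_empty, zero_mul])
  have h2 := hshift (fun i => (σ ^ i) b) (by simp [hσ])
  rw [map_neg, map_sum]
  simp_rw [map_mul, hσS, hs, sub_mul]
  rw [Finset.sum_sub_distrib, h1, ← Finset.mul_sum, h2, hb]
  ring

theorem AlgHom.apply_eq_self_of_pow_char_eq {E F : Type} [Field E] [Field F] [Algebra E F]
    {p : ℕ} [Fact p.Prime] [CharP F p] (σ : F →ₐ[E] F) {c : F} (hc : c ^ p = c) : σ c = c := by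
  have h := (Subfield.mem_bot_iff_pow_eq_self F p).mpr hc
  exact (bot_le : ⊥ ≤ RingHom.eqLocusField (σ : F →+* F) (RingHom.id F)) h

theorem artinSchreier_ne {E F : Type} [Field E] [Field F] [Algebra E F] {p : ℕ} [Fact p.Prime]
    [CharP F p] (σ : F →ₐ[E] F) {n : ℕ} (hpn : p ∣ n) (hσ : σ ^ n = 1) {b γ : F}
    (hb : ∑ i ∈ Finset.range n, (σ ^ i) b = 1) (hγ : σ γ = γ + (b ^ p - b)) (w : E) (r : F) :
    r ^ p - r ≠ γ + algebraMap E F w := by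
  intro hr
  have hc : (σ r - r - b) ^ p = σ r - r - b := by
    have h1 := congr_arg σ hr
    rw [map_sub, map_pow, map_add, hγ, AlgHom.commutes] at h1
    rw [sub_pow_char, sub_pow_char]
    linear_combination h1 - hr
  have hfix (i : ℕ) : (σ ^ i) (σ r - r - b) = σ r - r - b :=
    AlgHom.apply_eq_self_of_pow_char_eq _ hc
  have h2 : ∑ i ∈ Finset.range n, (σ ^ i) (σ r - r) = 0 := by
    have hs (i : ℕ) : (σ ^ i) (σ r - r) = (σ ^ (i + 1)) r - (σ ^ i) r := by
      rw [map_sub, pow_succ, AlgHom.mul_apply]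
    simp_rw [hs]
    rw [Finset.sum_range_sub fun i => (σ ^ i) r, hσ]
    simp
  have h3 : ∑ i ∈ Finset.range n, (σ ^ i) (σ r - r - b) = 0 := by
    simp_rw [hfix]
    rw [Finset.sum_const, Finset.card_range, nsmul_eq_mul, (CharP.cast_eq_zero_iff F p n).mpr hpn,
      zero_mul]
  simp_rw [map_sub _ (σ r - r) b] at h3
  rw [Finset.sum_sub_distrib, h2, hb] at h3
  simp at h3

theorem RatFunc.artinSchreier_ne_X {k : Type} [Field k] {p : ℕ} (hp : 1 < p) (r : RatFunc k) :
    r ^ p - r ≠ RatFunc.X := by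
  intro h
  have h_int : IsIntegral k[X] r := by
    refine ⟨Polynomial.X ^ p - Polynomial.X - Polynomial.C Polynomial.X,
      (monic_X_pow_sub_X_sub_C hp _).1, ?_⟩
    simp [h]
  obtain ⟨q, rfl⟩ := IsIntegrallyClosed.isIntegral_iff.mp h_int
  have hq : q ^ p - q = Polynomial.X := by
    apply RatFunc.algebraMap_injective k
    rw [map_sub, map_pow, h, RatFunc.algebraMap_X]
  by_cases hd : q.natDegree = 0
  · rw [eq_C_of_natDegree_eq_zero hd, ← C_pow, ← C_sub] at hq
    simpa using congr_arg natDegree hq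
  · have h1 : q.natDegree < (q ^ p).natDegree := by
      rw [natDegree_pow]
      exact lt_mul_of_one_lt_left (Nat.pos_of_ne_zero hd) hp
    have h2 := congr_arg natDegree hq
    rw [natDegree_sub_eq_left_of_natDegree_lt h1, natDegree_X, natDegree_pow] at h2
    have := Nat.eq_one_of_mul_eq_one_right h2
    omega

open scoped RatFunc LaurentSeries

/-- A cyclic extension of degree `n` of `k(X)` inside `k((X))`, together with an element of
trace one whose conjugates are power series with prescribed constant coefficients. -/
def HasCyclicTower (k : Type) [Field k] (n : ℕ) : Prop :=
  ∃ (F : Type) (_ : Field F) (_ : Algebra (RatFunc k) F) (j : F →ₐ[RatFunc k] LaurentSeries k)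
    (σ : F →ₐ[RatFunc k] F) (b : F) (β : ℕ → PowerSeries k),
    Module.finrank (RatFunc k) F = n ∧ σ ^ n = 1 ∧
    (∀ i, j ((σ ^ i) b) = HahnSeries.ofPowerSeries ℤ k (β i)) ∧
    (∀ i, PowerSeries.constantCoeff (β i) = if n ∣ i then 1 else 0) ∧
    ∑ i ∈ Finset.range n, (σ ^ i) b = 1

theorem hasCyclicTower_one (k : Type) [Field k] : HasCyclicTower k 1 :=
  ⟨RatFunc k, inferInstance, inferInstance, Algebra.ofId _ _, 1, 1, fun _ => 1, by simp⟩

theorem algebraMap_ratFunc_laurentSeries {k : Type} [Field k] (q : k[X]) :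
    algebraMap (RatFunc k) (LaurentSeries k) (algebraMap k[X] (RatFunc k) q)
      = HahnSeries.ofPowerSeries ℤ k (q : PowerSeries k) := by
  rw [← IsScalarTower.algebraMap_apply]
  rfl

theorem HasCyclicTower.mul {k : Type} [Field k] {p : ℕ} [Fact p.Prime] [CharP k p] {n : ℕ}
    (hn : n = 1 ∨ p ∣ n) (h : HasCyclicTower k n) : HasCyclicTower k (n * p) := by
  have hp := (Fact.out : p.Prime)
  obtain ⟨F, _, _, j, σ, b, β, hfin, hσ, hjβ, hβ, hb⟩ := h
  have hn0 : n ≠ 0 := by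
    rintro rfl
    simp at hb
  have : CharP (RatFunc k) p := charP_of_injective_algebraMap (algebraMap k (RatFunc k)).injective p
  have : CharP F p := charP_of_injective_algebraMap (algebraMap (RatFunc k) F).injective p
  have : CharP (PowerSeries k) p := by
    refine charP_of_injective_ringHom (f := (PowerSeries.C : k →+* PowerSeries k)) ?_ p
    exact PowerSeries.C_injective
  have hx : ∑ i ∈ Finset.range n, (σ ^ i) (b ^ p - b) = 0 := by
    simp_rw [map_sub, map_pow]
    rw [Finset.sum_sub_distrib, ← sum_pow_char, hb, one_pow, sub_self]
  have hγ := additive_hilbert_ninety σ hσ hb hx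
  set γ : F := -∑ i ∈ Finset.range n, (∑ l ∈ Finset.range i, (σ ^ l) (b ^ p - b)) * (σ ^ i) b
    with hγ_def
  let Γ : PowerSeries k :=
    -∑ i ∈ Finset.range n, (∑ l ∈ Finset.range i, (β l ^ p - β l)) * β i
  have hΓ : j γ = HahnSeries.ofPowerSeries ℤ k Γ := by
    simp only [hγ_def, Γ, map_neg, map_sum, map_mul, map_sub, map_pow, hjβ]
  have hΓ0 : PowerSeries.constantCoeff Γ = 0 := by
    have h (l : ℕ) : PowerSeries.constantCoeff (β l ^ p - β l) = 0 := by
      rw [map_sub, map_pow, hβ]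
      split_ifs <;> simp [hp.ne_zero]
    simp only [Γ, map_neg, map_sum, map_mul, h]
    simp
  let w : RatFunc k := RatFunc.X
  have hw : algebraMap (RatFunc k) (LaurentSeries k) w
      = HahnSeries.ofPowerSeries ℤ k PowerSeries.X := by
    rw [← Polynomial.coe_X, ← algebraMap_ratFunc_laurentSeries, RatFunc.algebraMap_X]
  have hroot (r : F) : r ^ p - r ≠ γ + algebraMap (RatFunc k) F w := by
    obtain rfl | hpn := hn
    · have hγ0 : γ = 0 := by simp [hγ_def]
      rw [hγ0, zero_add]
      obtain ⟨s, rfl⟩ : ∃ s, algebraMap (RatFunc k) F s = r := by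
        obtain ⟨s, hs⟩ := (finrank_eq_one_iff_of_nonzero' (1 : F) one_ne_zero).1 hfin r
        exact ⟨s, by rw [Algebra.algebraMap_eq_smul_one, hs]⟩
      rw [← map_pow, ← map_sub]
      exact fun h => RatFunc.artinSchreier_ne_X hp.one_lt s ((algebraMap (RatFunc k) F).injective h)
    · exact artinSchreier_ne σ hpn hσ hb hγ w r
  obtain ⟨Y, hY, hY0⟩ := PowerSeries.exists_isRoot_of_simple
    (X ^ p - X - C (Γ + PowerSeries.X)) (monic_X_pow_sub_X_sub_C hp.one_lt _).1 0
    (by simp [hΓ0, hp.ne_zero]) (by simp [derivative_X_pow])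
  simp only [eval_sub, eval_pow, eval_X, eval_C] at hY
  rw [map_zero] at hY0
  let f : F[X] := X ^ p - X - C (γ + algebraMap (RatFunc k) F w)
  have hf : f.Monic ∧ f.natDegree = p := monic_X_pow_sub_X_sub_C hp.one_lt _
  have : Fact (Irreducible f) := ⟨irreducible_X_pow_sub_X_sub_C _ hroot⟩
  let F' := AdjoinRoot f
  have : CharP F' p := charP_of_injective_algebraMap (algebraMap F F').injective p
  let y : F' := AdjoinRoot.root f
  let o : F →ₐ[RatFunc k] F' := IsScalarTower.toAlgHom (RatFunc k) F F'
  have hy : y ^ p - y = o γ + algebraMap (RatFunc k) F' w := by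
    have h := AdjoinRoot.eval₂_root f
    simp only [f, eval₂_sub, eval₂_pow, eval₂_X, eval₂_C, sub_eq_zero] at h
    exact h.trans (map_add (AdjoinRoot.of f) _ _)
  let j' : F' →ₐ[RatFunc k] LaurentSeries k :=
    AdjoinRoot.liftAlgHom f j (HahnSeries.ofPowerSeries ℤ k Y) (by
      simp only [f, eval₂_sub, eval₂_pow, eval₂_X, eval₂_C, ← map_pow, ← map_sub]
      rw [RingHom.coe_coe, map_add, AlgHom.commutes, hΓ, hw, ← map_add, ← map_sub, hY, map_zero])
  let σ' : F' →ₐ[RatFunc k] F' := AdjoinRoot.liftAlgHom f (o.comp σ) (y + o b) (by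
      simp only [f, eval₂_sub, eval₂_pow, eval₂_X, eval₂_C]
      rw [RingHom.coe_coe, map_add, AlgHom.commutes, AlgHom.comp_apply, hγ, add_pow_char, map_add,
        map_sub, map_pow]
      linear_combination hy)
  have hj'o (a : F) : j' (o a) = j a := AdjoinRoot.liftAlgHom_of ..
  have hj'y : j' y = HahnSeries.ofPowerSeries ℤ k Y := AdjoinRoot.liftAlgHom_root ..
  have hσ'o (a : F) : σ' (o a) = o (σ a) := AdjoinRoot.liftAlgHom_of ..
  have hσ'y : σ' y = y + o b := AdjoinRoot.liftAlgHom_root ..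
  have hσ'io (i : ℕ) (a : F) : (σ' ^ i) (o a) = o ((σ ^ i) a) := by
    induction i with
    | zero => simp
    | succ i ih => rw [pow_succ', pow_succ', AlgHom.mul_apply, AlgHom.mul_apply, ih, hσ'o]
  let B : ℕ → F := fun i => ∑ l ∈ Finset.range i, (σ ^ l) b
  have hσ'iy (i : ℕ) : (σ' ^ i) y = y + o (B i) := by
    induction i with
    | zero => simp [B]
    | succ i ih =>
      rw [pow_succ, AlgHom.mul_apply, hσ'y, map_add, ih, hσ'io, add_assoc, ← map_add]
      simp only [B, Finset.sum_range_succ]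
  have hσq (q : ℕ) : σ ^ (n * q) = 1 := by rw [pow_mul, hσ, one_pow]
  have hB (q r : ℕ) : B (n * q + r) = q + B r := by
    have h1 (q : ℕ) : B (n * q) = q := by
      induction q with
      | zero => simp [B]
      | succ q ih =>
        simp only [B] at ih ⊢
        rw [mul_add, mul_one, Finset.sum_range_add, ih]
        simp_rw [pow_add, hσq, one_mul]
        rw [hb, Nat.cast_add, Nat.cast_one]
    have h2 := h1 q
    simp only [B] at h2 ⊢
    rw [Finset.sum_range_add, h2]
    simp_rw [pow_add, hσq, one_mul]
  have hσ'np : σ' ^ (n * p) = 1 := by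
    refine AdjoinRoot.algHom_ext' (AlgHom.ext fun a => ?_) ?_
    · exact (hσ'io (n * p) a).trans (by rw [hσq]; rfl)
    · refine (hσ'iy (n * p)).trans ?_
      have h := hB p 0
      rw [add_zero, CharP.cast_eq_zero, zero_add] at h
      rw [h]
      simp [B, y]
  let b' : F' := o b * (1 - y ^ (p - 1))
  have hb'i (i : ℕ) : (σ' ^ i) b' = o ((σ ^ i) b) * (1 - (y + o (B i)) ^ (p - 1)) := by
    rw [map_mul, map_sub, map_one, map_pow, hσ'io, hσ'iy]
  refine ⟨F', inferInstance, inferInstance, j', σ', b', fun i => β i *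
    (1 - (Y + ∑ l ∈ Finset.range i, β l) ^ (p - 1)), ?_, hσ'np, fun i => ?_, fun i => ?_, ?_⟩
  · rw [← Module.finrank_mul_finrank (RatFunc k) F F', hfin,
      (AdjoinRoot.powerBasis hf.1.ne_zero).finrank, AdjoinRoot.powerBasis_dim, hf.2]
  · rw [hb'i]
    simp only [map_mul, map_sub, map_one, map_pow, map_add, hj'o, hj'y, hjβ, B, map_sum]
  · rw [map_mul, map_sub, map_one, map_pow, map_add, hY0, zero_add, hβ]
    by_cases hni : n ∣ i
    · obtain ⟨q, rfl⟩ := hni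
      have hBq : ∑ l ∈ Finset.range (n * q), β l = q := by
        have h := congrArg j (hB q 0)
        simp only [B, add_zero, Finset.range_zero, Finset.sum_empty, map_sum, hjβ, map_natCast] at h
        rw [← map_sum, ← map_natCast (HahnSeries.ofPowerSeries ℤ k)] at h
        exact HahnSeries.ofPowerSeries_injective h
      rw [hBq, map_natCast, if_pos (dvd_mul_right n q), one_mul]
      simp only [Nat.mul_dvd_mul_iff_left (Nat.pos_of_ne_zero hn0)]
      split_ifs with hpq
      · rw [(CharP.cast_eq_zero_iff k p q).2 hpq, zero_pow (Nat.sub_pos_of_lt hp.one_lt).ne',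
          sub_zero]
      · have h : (q : ZMod p) ^ (p - 1) = 1 :=
          ZMod.pow_card_sub_one_eq_one (by rwa [Ne, CharP.cast_eq_zero_iff (ZMod p) p])
        have h' := congrArg (ZMod.castHom dvd_rfl k) h
        rw [map_pow, map_natCast, map_one] at h'
        rw [h', sub_self]
    · rw [if_neg hni, zero_mul, if_neg fun h => hni (dvd_of_mul_right_dvd h)]
  · have hsum : ∑ i ∈ Finset.range (n * p), (σ' ^ i) b'
        = ∑ r ∈ Finset.range n, ∑ q ∈ Finset.range p, (σ' ^ (n * q + r)) b' := by
      rw [Finset.sum_comm]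
      have (m : ℕ) : ∑ i ∈ Finset.range (n * m), (σ' ^ i) b'
          = ∑ q ∈ Finset.range m, ∑ r ∈ Finset.range n, (σ' ^ (n * q + r)) b' := by
        induction m with
        | zero => simp
        | succ m ih => rw [mul_add, mul_one, Finset.sum_range_add, ih, Finset.sum_range_succ]
      exact this p
    rw [hsum]
    have hr (r : ℕ) : ∑ q ∈ Finset.range p, (σ' ^ (n * q + r)) b' = o ((σ ^ r) b) := by
      simp_rw [hb'i, hB, pow_add, hσq, one_mul, map_add, map_natCast]
      rw [← Finset.mul_sum, Finset.sum_sub_distrib]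
      have h := sum_add_natCast_pow_sub_one (p := p) (y + o (B r))
      simp_rw [add_right_comm y, ← add_assoc] at h ⊢
      rw [h]
      simp
    simp_rw [hr, ← map_sum, hb, map_one]

end ArtinSchreier

/-! ### Cyclic split torsors of order a power of the characteristic -/

section ArtinSchreierTorsor

open Polynomial
open scoped RatFunc LaurentSeries

theorem PowerSeries.eq_zero_of_shift_invariant {k : Type} [Field k] {n : ℕ} [NeZero n]
    (β : ZMod n → PowerSeries k)
    (hconst : ∀ i, PowerSeries.constantCoeff (β i) = if i = 0 then 1 else 0)
    (hshift : ∀ p : ZMod n → k[X], ∑ i, (p i : PowerSeries k) * β i = 0 →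
      ∀ c, ∑ i, (p i : PowerSeries k) * β (i + c) = 0)
    (p : ZMod n → k[X]) (hp : ∑ i, (p i : PowerSeries k) * β i = 0) (i : ZMod n) : p i = 0 := by
  have key (N : ℕ) : ∀ p : ZMod n → k[X], ∑ i, (p i : PowerSeries k) * β i = 0 →
      ∀ i, Polynomial.X ^ N ∣ p i := by
    induction N with
    | zero => simp
    | succ N ih =>
      intro p hp
      have hX (i : ZMod n) : Polynomial.X ∣ p i := by
        have h := congrArg PowerSeries.constantCoeff (hshift p hp (-i))
        simp only [map_sum, map_mul, hconst, map_zero, add_neg_eq_zero, mul_ite, mul_one, mul_zero,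
          Finset.sum_ite_eq', Finset.mem_univ, if_true] at h
        rw [Polynomial.X_dvd_iff]
        simpa using h
      choose q hq using hX
      intro i
      rw [hq i, pow_succ']
      refine mul_dvd_mul_left _ (ih q ?_ i)
      have hX0 : (PowerSeries.X : PowerSeries k) ≠ 0 := PowerSeries.X_ne_zero
      apply mul_left_cancel₀ hX0
      rw [mul_zero, ← hp, Finset.mul_sum]
      refine Finset.sum_congr rfl fun i _ => ?_
      conv_rhs => rw [hq i]
      rw [Polynomial.coe_mul, Polynomial.coe_X, mul_assoc]
  refine eq_zero_of_dvd_of_natDegree_lt (key ((p i).natDegree + 1) p hp i) ?_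
  rw [natDegree_X_pow]
  exact Nat.lt_succ_self _

theorem HasCyclicTower.exists_isSplitTorsor {k : Type} [Field k] {n : ℕ} [NeZero n]
    (h : HasCyclicTower k n) : ∃ β : Multiplicative (ZMod n) → PowerSeries k,
      IsSplitTorsor β := by
  obtain ⟨F, _, _, j, σ, b, β, hfin, hσ, hjβ, hβ, hb⟩ := h
  let s (i : ZMod n) : F := (σ ^ i.val) b
  have hs (c i : ZMod n) : (σ ^ c.val) (s i) = s (i + c) := by
    simp only [s]
    rw [← AlgHom.mul_apply, ← pow_add, ZMod.val_add, ← pow_eq_pow_mod _ hσ, add_comm]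
  let β' (i : ZMod n) : PowerSeries k := β i.val
  have hjs (i : ZMod n) : j (s i) = HahnSeries.ofPowerSeries ℤ k (β' i) := hjβ _
  let ι : k[X] →+* F := (algebraMap (RatFunc k) F).comp (algebraMap k[X] (RatFunc k))
  have hjι (q : k[X]) : j (ι q) = HahnSeries.ofPowerSeries ℤ k (q : PowerSeries k) := by
    rw [RingHom.comp_apply, AlgHom.commutes, algebraMap_ratFunc_laurentSeries]
  have hσι (c : ℕ) (q : k[X]) : (σ ^ c) (ι q) = ι q := AlgHom.commutes _ _
  have hinj : Function.Injective (HahnSeries.ofPowerSeries ℤ k) :=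
    HahnSeries.ofPowerSeries_injective
  have htransfer (q : ZMod n → k[X]) (f : ZMod n → ZMod n) :
      j (∑ i, ι (q i) * s (f i)) =
        HahnSeries.ofPowerSeries ℤ k (∑ i, (q i : PowerSeries k) * β' (f i)) := by
    simp only [map_sum, map_mul, hjι, hjs]
  have hshift (q : ZMod n → k[X]) (c : ZMod n) :
      (σ ^ c.val) (∑ i, ι (q i) * s i) = ∑ i, ι (q i) * s (i + c) := by
    simp only [map_sum, map_mul, hσι, hs]
  have hconst (i : ZMod n) : PowerSeries.constantCoeff (β' i) = if i = 0 then 1 else 0 := by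
    rw [hβ]
    congr 1
    rw [← ZMod.natCast_eq_zero_iff, ZMod.natCast_zmod_val]
  have hindep : ∀ p : ZMod n → k[X], ∑ i, (p i : PowerSeries k) * β' i = 0 → ∀ i, p i = 0 :=
    PowerSeries.eq_zero_of_shift_invariant β' hconst fun p hp c => by
      have h := htransfer p id
      simp only [id] at h
      rw [hp, map_zero, map_eq_zero] at h
      apply hinj
      rw [map_zero, ← htransfer p (· + c), ← hshift, h, map_zero, map_zero]
  have hli : LinearIndependent (RatFunc k) s := by
    let : Algebra k[X] F := ι.toAlgebra
    have : IsScalarTower k[X] (RatFunc k) F := .of_algebraMap_eq fun _ => rfl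
    rw [← LinearIndependent.iff_fractionRing k[X], Fintype.linearIndependent_iff]
    intro p hp
    refine hindep p (hinj ?_)
    have h := htransfer p id
    simp only [id] at h
    rw [← h, map_zero]
    convert map_zero j
    rw [← hp]
    refine Finset.sum_congr rfl fun i _ => ?_
    rw [Algebra.smul_def]
    rfl
  let B := basisOfLinearIndependentOfCardEqFinrank hli (by rw [hfin, ZMod.card])
  have hB (i : ZMod n) : B i = s i := by simp [B]
  obtain ⟨⟨d, hd⟩, hdc⟩ := IsLocalization.exist_integer_multiples_of_finite
    (nonZeroDivisors k[X]) (S := RatFunc k)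
    fun x : ZMod n × ZMod n × ZMod n => B.repr (s x.1 * s x.2.1) x.2.2
  choose c hc using hdc
  have hmul (a b τ : ZMod n) :
      ι d * (s (a + τ) * s (b + τ)) = ∑ h, ι (c (a, b, h)) * s (h + τ) := by
    rw [← hshift, ← hs, ← hs, ← hσι τ.val d, ← map_mul, ← map_mul]
    congr 1
    rw [← B.sum_repr (s a * s b), Finset.mul_sum]
    refine Finset.sum_congr rfl fun h _ => ?_
    have h1 : ι (c (a, b, h)) = ι d * algebraMap (RatFunc k) F (B.repr (s a * s b) h) := by
      simp only [ι, RingHom.comp_apply]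
      rw [hc, ← map_mul, ← Algebra.smul_def]
    rw [h1, Algebra.smul_def, hB, mul_assoc]
  refine ⟨_, IsSplitTorsor.of_zmod β' hconst hindep
    ⟨d, nonZeroDivisors.ne_zero hd, fun a b h => c (a, b, h), fun a b τ => hinj ?_⟩ (hinj ?_)⟩
  · rw [← htransfer (fun h => c (a, b, h)) (· + τ), ← hmul]
    simp only [map_mul, hjι, hjs]
  · rw [map_sum, map_one, ← map_one j, ← hb, map_sum]
    simp_rw [hjβ]
    rw [Finset.sum_range]
    obtain ⟨m, rfl⟩ := Nat.exists_eq_succ_of_ne_zero (NeZero.ne n)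
    rfl

theorem hasCyclicTower_pow (k : Type) [Field k] (p : ℕ) [Fact p.Prime] [CharP k p] (m : ℕ) :
    HasCyclicTower k (p ^ m) := by
  induction m with
  | zero => simpa using hasCyclicTower_one k
  | succ m ih =>
    rw [pow_succ]
    refine ih.mul (p := p) ?_
    obtain rfl | hm := eq_or_ne m 0
    · simp
    · exact .inr (dvd_pow_self p hm)

end ArtinSchreierTorsor

/-! ### Cyclic split torsors of order prime to the characteristic -/

section Kummer

open Polynomial PowerSeries

theorem rescale_pow_of_pow_eq {L : Type} [Field L] {n : ℕ} (ψ : AddChar (ZMod n) L) {u : L⟦X⟧}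
    (hu : u ^ n = 1 + PowerSeries.X) (e : ZMod n) :
    rescale (ψ e) u ^ n = ((1 + Polynomial.C (ψ e) * Polynomial.X : L[X]) : L⟦X⟧) := by
  rw [← map_pow, hu, map_add, map_one, rescale_X]
  simp

variable {k L : Type} [Field k] [Field L] [Algebra k L] {n : ℕ} [NeZero n]
  (ψ : AddChar (ZMod n) L) (u : L⟦X⟧)

/-- The product of the radicals `rescale (ψ e) u` with exponents twisted so that `Gal(L/k)`
permutes these products. -/
noncomputable def kummerProd (j : ZMod n) : L⟦X⟧ :=
  ∏ e : (ZMod n)ˣ, rescale (ψ e) u ^ (j * (e⁻¹ : (ZMod n)ˣ)).val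

/-- The polynomial comparing products of radicals. -/
noncomputable def kummerFactor (j l : ZMod n) : L[X] :=
  ∏ e : (ZMod n)ˣ, (1 + Polynomial.C (ψ e) * Polynomial.X) ^
    (((j * (e⁻¹ : (ZMod n)ˣ)).val + (l * (e⁻¹ : (ZMod n)ˣ)).val) / n)

theorem kummerProd_zero : kummerProd ψ u 0 = 1 := by
  simp [kummerProd]

theorem constantCoeff_kummerProd (hu : constantCoeff u = 1) (j : ZMod n) :
    constantCoeff (kummerProd ψ u j) = 1 := by
  simp only [kummerProd, map_prod, map_pow]
  refine Finset.prod_eq_one fun e _ => ?_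
  rw [← coeff_zero_eq_constantCoeff_apply, coeff_rescale, coeff_zero_eq_constantCoeff_apply, hu]
  simp

theorem kummerProd_mul {u : L⟦X⟧} (hu : u ^ n = 1 + PowerSeries.X) (j l : ZMod n) :
    kummerProd ψ u j * kummerProd ψ u l = kummerFactor ψ j l * kummerProd ψ u (j + l) := by
  have h : ((kummerFactor ψ j l : L[X]) : L⟦X⟧) = ∏ e : (ZMod n)ˣ, (rescale (ψ e) u ^ n) ^
    (((j * (e⁻¹ : (ZMod n)ˣ)).val + (l * (e⁻¹ : (ZMod n)ˣ)).val) / n) := by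
    simp_rw [rescale_pow_of_pow_eq ψ hu]
    exact (map_prod (Polynomial.coeToPowerSeries.ringHom) _ _).trans (by simp)
  rw [h, kummerProd, kummerProd, kummerProd, ← Finset.prod_mul_distrib, ← Finset.prod_mul_distrib]
  refine Finset.prod_congr rfl fun e _ => ?_
  rw [add_mul, ZMod.val_add, ← pow_add, ← pow_mul, ← pow_add, Nat.div_add_mod]

theorem map_kummerProd (γ : L →+* L) (c : (ZMod n)ˣ) (hγ : ∀ a, γ (ψ a) = ψ (c * a))
    (hu : PowerSeries.map γ u = u) (j : ZMod n) :
    PowerSeries.map γ (kummerProd ψ u j) = kummerProd ψ u (c * j) := by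
  rw [kummerProd, kummerProd, map_prod]
  refine Fintype.prod_equiv (Equiv.mulLeft c) _ _ fun e => ?_
  have h : PowerSeries.map γ (rescale (ψ e) u) = rescale (ψ (c * e)) u := by
    ext m
    conv_rhs => rw [← hu]
    simp [hγ]
  rw [map_pow, h]
  simp only [Equiv.coe_mulLeft, Units.val_mul, mul_inv_rev]
  congr 2
  rw [mul_comm (_ : ZMod n) (c⁻¹ : (ZMod n)ˣ), ← mul_assoc, mul_comm (c : ZMod n) j, mul_assoc j,
    Units.mul_inv, mul_one]

theorem map_kummerFactor (γ : L →+* L) (c : (ZMod n)ˣ) (hγ : ∀ a, γ (ψ a) = ψ (c * a))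
    (j l : ZMod n) :
    Polynomial.map γ (kummerFactor ψ j l) = kummerFactor ψ (c * j) (c * l) := by
  rw [kummerFactor, kummerFactor, Polynomial.map_prod]
  refine Fintype.prod_equiv (Equiv.mulLeft c) _ _ fun e => ?_
  have h (j : ZMod n) : c * j * ((c * e)⁻¹ : (ZMod n)ˣ) = j * (e⁻¹ : (ZMod n)ˣ) := by
    rw [mul_inv_rev, Units.val_mul, mul_comm (_ : ZMod n) (c⁻¹ : (ZMod n)ˣ), ← mul_assoc,
      mul_comm (c : ZMod n) j, mul_assoc j, Units.mul_inv, mul_one]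
  simp only [Equiv.coe_mulLeft, h]
  simp [hγ]

theorem Polynomial.eq_zero_of_natDegree_lt_of_eisenstein {R S : Type} [CommRing R] [IsDomain R]
    [IsIntegrallyClosed R] [CommRing S] [IsDomain S] [Algebra R S] [FaithfulSMul R S]
    {π b : R} (hπ : Prime π) (hb : ¬ π ∣ b) {n : ℕ} (hn : n ≠ 0) {y : S}
    (hy : y ^ n = algebraMap R S (π * b)) (P : R[X]) (hP : P.natDegree < n)
    (h0 : aeval y P = 0) : P = 0 := by
  have hmonic : (Polynomial.X ^ n - Polynomial.C (π * b) : R[X]).Monic := monic_X_pow_sub_C _ hn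
  have hdeg : (Polynomial.X ^ n - Polynomial.C (π * b) : R[X]).natDegree = n :=
    natDegree_X_pow_sub_C
  have hirr : Irreducible (Polynomial.X ^ n - Polynomial.C (π * b) : R[X]) := by
    refine IsEisensteinAt.irreducible (𝓟 := Ideal.span {π}) ?_
      ((Ideal.span_singleton_prime hπ.ne_zero).mpr hπ) hmonic.isPrimitive (by omega)
    refine ⟨?_, fun {m} hm => ?_, ?_⟩
    · rw [hmonic.leadingCoeff, Ideal.mem_span_singleton]
      exact fun h => hπ.not_isUnit (isUnit_of_dvd_one h)
    · rw [hdeg] at hm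
      rw [coeff_sub, coeff_X_pow, if_neg hm.ne, coeff_C, zero_sub]
      split_ifs with h
      · exact neg_mem (Ideal.mem_span_singleton.mpr (dvd_mul_right _ _))
      · simp
    · rw [coeff_sub, coeff_X_pow, if_neg hn.symm, coeff_C_zero, zero_sub, neg_mem_iff,
        Ideal.span_singleton_pow, Ideal.mem_span_singleton, sq]
      exact fun h => hb ((mul_dvd_mul_iff_left hπ.ne_zero).mp h)
  have hroot : aeval y (Polynomial.X ^ n - Polynomial.C (π * b) : R[X]) = 0 := by
    simp [hy]
  have h_int : IsIntegral R y := ⟨_, hmonic, by simpa [aeval_def] using hroot⟩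
  have hdvd := minpoly.isIntegrallyClosed_dvd h_int hroot
  have hass : Associated (minpoly R y) (Polynomial.X ^ n - Polynomial.C (π * b) : R[X]) :=
    (hirr.dvd_iff.mp hdvd).resolve_left (minpoly.not_isUnit R y) |>.symm
  have := hass.symm.dvd.trans (minpoly.isIntegrallyClosed_dvd h_int h0)
  by_contra hP0
  exact absurd (natDegree_le_of_dvd this hP0) (by omega)

theorem kummerProd_one_pow (hψ : Function.Injective ψ) (hn : 1 < n) {u : L⟦X⟧}
    (hu : u ^ n = 1 + PowerSeries.X) :
    ∃ π b : L[X], Prime π ∧ ¬ π ∣ b ∧ kummerProd ψ u 1 ^ n = algebraMap L[X] L⟦X⟧ (π * b) := by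
  classical
  have : Fact (1 < n) := ⟨hn⟩
  refine ⟨1 + Polynomial.C (ψ 1) * Polynomial.X, ∏ e ∈ Finset.univ.erase (1 : (ZMod n)ˣ),
    (1 + Polynomial.C (ψ e) * Polynomial.X) ^ ((e⁻¹ : (ZMod n)ˣ) : ZMod n).val, ?_, ?_, ?_⟩
  · refine (irreducible_of_degree_eq_one ?_).prime
    rw [add_comm]
    exact degree_linear ((ψ.val_isUnit 1).ne_zero)
  · intro h
    have h1 := (Polynomial.eval_dvd (x := -(ψ 1)⁻¹) h)
    have h0 : ψ 1 ≠ 0 := (ψ.val_isUnit 1).ne_zero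
    rw [Polynomial.eval_prod] at h1
    simp only [eval_add, eval_one, eval_mul, eval_C, eval_X, mul_neg, mul_inv_cancel₀ h0,
      add_neg_cancel, zero_dvd_iff, eval_pow] at h1
    obtain ⟨e, he, h2⟩ := Finset.prod_eq_zero_iff.mp h1
    have h3 := eq_zero_of_pow_eq_zero h2
    rw [← sub_eq_add_neg, sub_eq_zero, eq_mul_inv_iff_mul_eq₀ h0, one_mul] at h3
    exact (Finset.mem_erase.mp he).1 (Units.ext (hψ h3.symm))
  · have h : (1 + Polynomial.C (ψ 1) * Polynomial.X : L[X])
      = (1 + Polynomial.C (ψ (1 : (ZMod n)ˣ)) * Polynomial.X) ^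
        (((1 : (ZMod n)ˣ)⁻¹ : (ZMod n)ˣ) : ZMod n).val := by
      simp [ZMod.val_one]
    rw [h, Finset.mul_prod_erase Finset.univ (fun e : (ZMod n)ˣ =>
      (1 + Polynomial.C (ψ e) * Polynomial.X) ^ ((e⁻¹ : (ZMod n)ˣ) : ZMod n).val)
      (Finset.mem_univ 1), map_prod, kummerProd, ← Finset.prod_pow]
    refine Finset.prod_congr rfl fun e _ => ?_
    rw [one_mul, ← pow_mul, mul_comm, pow_mul, rescale_pow_of_pow_eq ψ hu, map_pow]
    rfl

/-- Powers of the first product of radicals are polynomial multiples of the other products. -/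
theorem exists_kummerProd_one_pow {u : L⟦X⟧} (hu : u ^ n = 1 + PowerSeries.X) (m : ℕ) :
    ∃ F : L[X], F ≠ 0 ∧ kummerProd ψ u 1 ^ m = F * kummerProd ψ u m := by
  induction m with
  | zero => exact ⟨1, one_ne_zero, by simp [kummerProd_zero]⟩
  | succ m ih =>
    obtain ⟨F, hF, h⟩ := ih
    refine ⟨F * kummerFactor ψ m 1, mul_ne_zero hF ?_, ?_⟩
    · refine Finset.prod_ne_zero_iff.mpr fun e _ => pow_ne_zero _ fun h => ?_
      simpa using congr_arg (Polynomial.eval 0) h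
    · rw [pow_succ, h, mul_assoc, kummerProd_mul ψ hu]
      push_cast
      ring

theorem kummerProd_indep (hψ : Function.Injective ψ) (hn : 1 < n) {u : L⟦X⟧}
    (hu : u ^ n = 1 + PowerSeries.X) (r : ZMod n → L[X])
    (h : ∑ j, (r j : L⟦X⟧) * kummerProd ψ u j = 0) (j : ZMod n) : r j = 0 := by
  classical
  obtain ⟨π, b, hπ, hb, hy⟩ := kummerProd_one_pow ψ hψ hn hu
  choose F hF0 hF using fun j : ZMod n => exists_kummerProd_one_pow ψ hu j.val
  have hD : ∀ j : ZMod n, ∏ i ∈ Finset.univ.erase j, F i ≠ 0 := fun j =>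
    Finset.prod_ne_zero_iff.mpr fun i _ => hF0 i
  let s : ZMod n → L[X] := fun j => r j * ∏ i ∈ Finset.univ.erase j, F i
  suffices hs : s j = 0 from (mul_eq_zero.mp hs).resolve_right (hD j)
  let P : L[X][X] := ∑ j : ZMod n, Polynomial.monomial j.val (s j)
  have : FaithfulSMul L[X] L⟦X⟧ :=
    (faithfulSMul_iff_algebraMap_injective _ _).mpr (Polynomial.coe_injective L)
  have hP : P = 0 := by
    refine eq_zero_of_natDegree_lt_of_eisenstein (S := L⟦X⟧) hπ hb (by omega) hy P ?_ ?_
    · refine lt_of_le_of_lt (natDegree_sum_le_of_forall_le (n := n - 1) _ _ fun j _ => ?_)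
        (Nat.sub_lt (by omega) one_pos)
      exact (natDegree_monomial_le _).trans (Nat.le_sub_one_of_lt j.val_lt)
    · simp only [P, map_sum, aeval_monomial, hF]
      calc _ = ((∏ i, F i : L[X]) : L⟦X⟧) * ∑ j, (r j : L⟦X⟧) * kummerProd ψ u j := by
            rw [Finset.mul_sum]
            refine Finset.sum_congr rfl fun j _ => ?_
            rw [← Finset.mul_prod_erase _ _ (Finset.mem_univ j), ZMod.natCast_zmod_val,
              Polynomial.coe_mul, show algebraMap L[X] L⟦X⟧ (s j) = (s j : L⟦X⟧) from rfl,
              Polynomial.coe_mul]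
            ring
        _ = 0 := by rw [h, mul_zero]
  have := congr_arg (fun Q => Q.coeff j.val) hP
  simpa [P, Polynomial.coeff_monomial, (ZMod.val_injective n).eq_iff] using this

/-- The Fourier transform of the products of radicals. -/
noncomputable def kummerNormal (i : ZMod n) : L⟦X⟧ :=
  ∑ j : ZMod n, ((Polynomial.C (ψ (i * j) / n) : L[X]) : L⟦X⟧) * kummerProd ψ u j

/-- The structure constants of the family `kummerNormal`. -/
noncomputable def kummerStruct (a b h : ZMod n) : L[X] :=
  ∑ j : ZMod n, ∑ l : ZMod n,
    Polynomial.C (ψ (a * j + b * l - h * (j + l)) / (n * n)) * kummerFactor ψ j l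

theorem sum_addChar_mul_div (hψ : ψ.IsPrimitive) (hn : (n : L) ≠ 0) (a b : ZMod n) :
    ∑ i, ψ (-(i * a)) * (ψ (i * b) / n) = if a = b then 1 else 0 := by
  have h := AddChar.sum_mulShift (b - a) hψ
  have h' : ∀ i, ψ (-(i * a)) * (ψ (i * b) / n) = ψ (i * (b - a)) / n := fun i => by
    rw [← mul_div_assoc, ← AddChar.map_add_eq_mul]
    congr 2; ring
  simp_rw [h', ← Finset.sum_div, h, ZMod.card, sub_eq_zero, eq_comm (a := a)]
  split_ifs <;> simp [hn]

variable {ψ} in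
theorem sum_mul_kummerNormal (hψ : ψ.IsPrimitive) (hn : (n : L) ≠ 0) (l : ZMod n) :
    ∑ i, ((Polynomial.C (ψ (-(i * l))) : L[X]) : L⟦X⟧) * kummerNormal ψ u i
      = kummerProd ψ u l := by
  simp_rw [kummerNormal, Finset.mul_sum, ← mul_assoc, ← Polynomial.coe_mul, ← Polynomial.C_mul]
  rw [Finset.sum_comm]
  simp_rw [← Finset.sum_mul, Polynomial.coe_C, ← map_sum, sum_addChar_mul_div ψ hψ hn]
  simp

theorem constantCoeff_kummerNormal (hψ : ψ.IsPrimitive) (hn : (n : L) ≠ 0)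
    (hu : constantCoeff u = 1) (i : ZMod n) :
    constantCoeff (kummerNormal ψ u i) = if i = 0 then 1 else 0 := by
  have h := sum_addChar_mul_div ψ hψ hn 0 i
  simp only [mul_zero, neg_zero, AddChar.map_zero_eq_one, one_mul] at h
  simp only [kummerNormal, map_sum, map_mul, constantCoeff_kummerProd ψ u hu, mul_one,
    Polynomial.coe_C, PowerSeries.constantCoeff_C, mul_comm i, h, eq_comm (a := (0 : ZMod n))]

theorem sum_kummerNormal (hψ : ψ.IsPrimitive) (hn : (n : L) ≠ 0) :
    ∑ i, kummerNormal ψ u i = 1 := by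
  have h := sum_mul_kummerNormal u hψ hn 0
  simpa [kummerProd_zero] using h

theorem map_kummerNormal (γ : L →+* L) (c : (ZMod n)ˣ) (hγ : ∀ a, γ (ψ a) = ψ (c * a))
    (hu : PowerSeries.map γ u = u) (i : ZMod n) :
    PowerSeries.map γ (kummerNormal ψ u i) = kummerNormal ψ u i := by
  rw [kummerNormal, map_sum]
  refine Fintype.sum_equiv (Units.mulLeft c) _ _ fun j => ?_
  rw [map_mul, map_kummerProd ψ u γ c hγ hu]
  simp [hγ, mul_left_comm]

theorem map_kummerStruct (γ : L →+* L) (c : (ZMod n)ˣ) (hγ : ∀ a, γ (ψ a) = ψ (c * a))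
    (a b h : ZMod n) : Polynomial.map γ (kummerStruct ψ a b h) = kummerStruct ψ a b h := by
  simp only [kummerStruct, Polynomial.map_sum, Polynomial.map_mul, map_kummerFactor ψ γ c hγ]
  refine Fintype.sum_equiv (Units.mulLeft c) _ _ fun j => ?_
  refine Fintype.sum_equiv (Units.mulLeft c) _ _ fun l => ?_
  have : (c : ZMod n) * (a * j + b * l - h * (j + l))
    = a * (c * j) + b * (c * l) - h * (c * j + c * l) := by ring
  simp [hγ, this]

theorem kummerStruct_add (a b h τ : ZMod n) :
    kummerStruct ψ (a + τ) (b + τ) (h + τ) = kummerStruct ψ a b h := by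
  refine Finset.sum_congr rfl fun j _ => Finset.sum_congr rfl fun l _ => ?_
  congr 4
  ring

theorem kummerNormal_mul (hψ : ψ.IsPrimitive) (hn : (n : L) ≠ 0) {u : L⟦X⟧}
    (hu : u ^ n = 1 + PowerSeries.X) (a b : ZMod n) :
    kummerNormal ψ u a * kummerNormal ψ u b
      = ∑ h, (kummerStruct ψ a b h : L⟦X⟧) * kummerNormal ψ u h := by
  have key : ∀ j l h : ZMod n,
      ((Polynomial.C (ψ (a * j + b * l - h * (j + l)) / (n * n)) : L[X]) : L⟦X⟧)
      = ((Polynomial.C (ψ (a * j) / n) : L[X]) : L⟦X⟧)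
        * ((Polynomial.C (ψ (b * l) / n) : L[X]) : L⟦X⟧)
        * ((Polynomial.C (ψ (-(h * (j + l)))) : L[X]) : L⟦X⟧) := fun j l h => by
    rw [← Polynomial.coe_mul, ← Polynomial.C_mul, ← Polynomial.coe_mul, ← Polynomial.C_mul,
      sub_eq_add_neg, AddChar.map_add_eq_mul, AddChar.map_add_eq_mul]
    congr 2
    field_simp
  have hs : ∀ h, (kummerStruct ψ a b h : L⟦X⟧) = ∑ j : ZMod n, ∑ l : ZMod n,
      ((Polynomial.C (ψ (a * j + b * l - h * (j + l)) / (n * n)) : L[X]) : L⟦X⟧)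
        * kummerFactor ψ j l := fun h => by
    rw [kummerStruct]
    simp only [← Polynomial.coeToPowerSeries.ringHom_apply, map_sum, map_mul]
  simp_rw [hs, Finset.sum_mul]
  rw [Finset.sum_comm]
  rw [kummerNormal, kummerNormal, Finset.sum_mul_sum]
  refine Finset.sum_congr rfl fun j _ => ?_
  rw [Finset.sum_comm]
  refine Finset.sum_congr rfl fun l _ => ?_
  rw [mul_mul_mul_comm, kummerProd_mul ψ hu, ← sum_mul_kummerNormal u hψ hn (j + l),
    Finset.mul_sum, Finset.mul_sum]
  refine Finset.sum_congr rfl fun h _ => ?_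
  rw [key]
  ring

theorem kummerNormal_indep (hψ : ψ.IsPrimitive) (hψ' : Function.Injective ψ) (hn : (n : L) ≠ 0)
    (hn1 : 1 < n) {u : L⟦X⟧} (hu : u ^ n = 1 + PowerSeries.X) (r : ZMod n → L[X])
    (h : ∑ j, (r j : L⟦X⟧) * kummerNormal ψ u j = 0) (i : ZMod n) : r i = 0 := by
  have h1 := kummerProd_indep ψ hψ' hn1 hu (fun j => ∑ i, r i * Polynomial.C (ψ (i * j) / n)) (by
    rw [← h]
    simp_rw [kummerNormal, Finset.mul_sum]
    rw [Finset.sum_comm]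
    refine Finset.sum_congr rfl fun j _ => ?_
    simp only [← Polynomial.coeToPowerSeries.ringHom_apply, map_sum, map_mul, Finset.sum_mul,
      mul_assoc])
  have h2 : ∑ j, Polynomial.C (ψ (-(j * i))) * ∑ l, r l * Polynomial.C (ψ (l * j) / n) = 0 :=
    Finset.sum_eq_zero fun j _ => by rw [h1 j, mul_zero]
  have h3 : ∀ l, ∑ j, Polynomial.C (ψ (-(j * i))) * (r l * Polynomial.C (ψ (l * j) / n))
      = r l * Polynomial.C (if i = l then 1 else 0) := fun l => by
    rw [← sum_addChar_mul_div ψ hψ hn i l, map_sum, Finset.mul_sum]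
    refine Finset.sum_congr rfl fun j _ => ?_
    rw [Polynomial.C_mul, mul_comm l]
    ring
  simp_rw [Finset.mul_sum] at h2
  rw [Finset.sum_comm] at h2
  simpa [h3] using h2

end Kummer

/-! ### Descent to the base field -/

section KummerDescent

open Polynomial PowerSeries

theorem PowerSeries.constantCoeff_map_apply {R S : Type} [CommRing R] [CommRing S] (f : R →+* S)
    (φ : R⟦X⟧) : constantCoeff (PowerSeries.map f φ) = f (constantCoeff φ) := by
  rw [← coeff_zero_eq_constantCoeff_apply, coeff_map, coeff_zero_eq_constantCoeff_apply]

theorem PowerSeries.exists_map_eq_of_fixed {k L : Type} [Field k] [Field L] [Algebra k L]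
    [FiniteDimensional k L] [IsGalois k L] (f : L⟦X⟧)
    (hf : ∀ γ : L ≃ₐ[k] L, PowerSeries.map (γ : L →+* L) f = f) :
    ∃ g : k⟦X⟧, PowerSeries.map (algebraMap k L) g = f := by
  have h : ∀ m, ∃ a, algebraMap k L a = PowerSeries.coeff m f := fun m =>
    (IsGalois.mem_range_algebraMap_iff_fixed _).mpr fun γ => by
      conv_rhs => rw [← hf γ]
      rw [PowerSeries.coeff_map]
      rfl
  choose a ha using h
  exact ⟨PowerSeries.mk a, by ext m; simp [ha]⟩

theorem Polynomial.exists_map_eq_of_fixed {k L : Type} [Field k] [Field L] [Algebra k L]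
    [FiniteDimensional k L] [IsGalois k L] (f : L[X])
    (hf : ∀ γ : L ≃ₐ[k] L, f.map (γ : L →+* L) = f) :
    ∃ g : k[X], g.map (algebraMap k L) = f := by
  refine (Polynomial.mem_lifts _).mp ((Polynomial.lifts_iff_coeff_lifts _).mpr fun m => ?_)
  refine (IsGalois.mem_range_algebraMap_iff_fixed _).mpr fun γ => ?_
  conv_rhs => rw [← hf γ]
  rw [Polynomial.coeff_map]
  rfl

theorem exists_isSplitTorsor_of_natCast_ne_zero (k : Type) [Field k] (n : ℕ) [NeZero n]
    (hn : (n : k) ≠ 0) : ∃ β : Multiplicative (ZMod n) → k⟦X⟧, IsSplitTorsor β := by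
  obtain hn1 | hn1 : n = 1 ∨ 1 < n := by
    have := NeZero.pos n
    omega
  · subst hn1
    have : Subsingleton (Multiplicative (ZMod 1)) := inferInstanceAs (Subsingleton (ZMod 1))
    exact ⟨_, isSplitTorsor_one⟩
  have : NeZero (n : k) := ⟨hn⟩
  let L := CyclotomicField n k
  have : IsGalois k L := IsCyclotomicExtension.isGalois {n} k L
  have : FiniteDimensional k L := IsCyclotomicExtension.finiteDimensional {n} k L
  have hnL : (n : L) ≠ 0 := by
    simpa using (map_ne_zero (algebraMap k L)).mpr hn
  have hζ := IsCyclotomicExtension.zeta_spec n k L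
  set ζ := IsCyclotomicExtension.zeta n k L
  let ψ : AddChar (ZMod n) L := AddChar.zmodChar n hζ.pow_eq_one
  have hψ : ψ.IsPrimitive := AddChar.zmodChar_primitive_of_primitive_root n hζ
  have hψ' : Function.Injective ψ := fun a b hab =>
    ZMod.val_injective n (hζ.pow_inj a.val_lt b.val_lt hab)
  have hγ : ∀ γ : L ≃ₐ[k] L, ∃ c : (ZMod n)ˣ, ∀ a, (γ : L →+* L) (ψ a) = ψ (c * a) := fun γ => by
    refine ⟨hζ.autToPow k γ, fun a => ?_⟩
    have h1 : γ ζ = ψ (hζ.autToPow k γ) := (hζ.autToPow_spec k γ).symm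
    have h2 : ψ a = ζ ^ a.val := rfl
    rw [h2, map_pow]
    change γ ζ ^ _ = _
    rw [h1, ← AddChar.map_nsmul_eq_pow]
    congr 1
    rw [nsmul_eq_mul, ZMod.natCast_zmod_val, mul_comm]
  obtain ⟨u₀, hu₀, hu₀'⟩ := PowerSeries.exists_pow_eq_one_add_X n hn
  let u : L⟦X⟧ := PowerSeries.map (algebraMap k L) u₀
  have hu : u ^ n = 1 + PowerSeries.X := by
    rw [← map_pow, hu₀, map_add, map_one, PowerSeries.map_X]
  have hu1 : constantCoeff u = 1 := by
    rw [PowerSeries.constantCoeff_map_apply, hu₀', map_one]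
  have huγ : ∀ γ : L ≃ₐ[k] L, PowerSeries.map (γ : L →+* L) u = u := fun γ => by
    ext m
    simp [u]
  have hβ : ∀ i, ∃ g : k⟦X⟧, PowerSeries.map (algebraMap k L) g = kummerNormal ψ u i := fun i =>
    PowerSeries.exists_map_eq_of_fixed _ fun γ =>
      map_kummerNormal ψ u γ _ (hγ γ).choose_spec (huγ γ) i
  have hc : ∀ a b h, ∃ g : k[X], g.map (algebraMap k L) = kummerStruct ψ a b h := fun a b h =>
    Polynomial.exists_map_eq_of_fixed _ fun γ => map_kummerStruct ψ γ _ (hγ γ).choose_spec a b h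
  choose β hβ using hβ
  choose c hc using hc
  have hinj := PowerSeries.map_injective (algebraMap k L) (algebraMap k L).injective
  have hcoe : ∀ p : k[X], PowerSeries.map (algebraMap k L) (p : k⟦X⟧)
      = ((p.map (algebraMap k L) : L[X]) : L⟦X⟧) := fun p => by simp
  refine ⟨_, IsSplitTorsor.of_zmod β (fun i => ?_) (fun p hp i => ?_)
    ⟨1, one_ne_zero, c, fun a b τ => ?_⟩ ?_⟩
  · apply (algebraMap k L).injective
    rw [← PowerSeries.constantCoeff_map_apply, hβ, constantCoeff_kummerNormal ψ u hψ hnL hu1]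
    simp
  · have h := kummerNormal_indep ψ hψ hψ' hnL hn1 hu (fun i => (p i).map (algebraMap k L)) (by
      simp_rw [← hcoe, ← hβ, ← map_mul, ← map_sum, hp, map_zero]) i
    exact (Polynomial.map_eq_zero _).mp h
  · apply hinj
    rw [Polynomial.coe_one, one_mul, map_mul, hβ, hβ, kummerNormal_mul ψ hψ hnL hu, map_sum]
    refine Fintype.sum_equiv (Equiv.subRight τ) _ _ fun h => ?_
    rw [map_mul, hcoe, hc, hβ, Equiv.subRight_apply, sub_add_cancel]
    congr 2
    conv_lhs => rw [← sub_add_cancel h τ, kummerStruct_add]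
  · apply hinj
    rw [map_sum, map_one, ← sum_kummerNormal ψ u hψ hnL]
    simp_rw [hβ]

end KummerDescent

theorem exists_isSplitTorsor_of_isCyclic (k : Type) [Field k] (H : Type) [Group H] [Fintype H]
    [IsCyclic H] (hH : ∃ p m, p.Prime ∧ Nat.card H = p ^ m) :
    ∃ β : H → PowerSeries k, IsSplitTorsor β := by
  obtain ⟨p, m, hp, hm⟩ := hH
  have : Fact p.Prime := ⟨hp⟩
  have hne : NeZero (p ^ m) := ⟨pow_ne_zero m hp.ne_zero⟩
  have hβ : ∃ β : Multiplicative (ZMod (p ^ m)) → PowerSeries k, IsSplitTorsor β := by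
    by_cases hpk : (p : k) = 0
    · have : CharP k p := by
        obtain ⟨q, hq⟩ := CharP.exists k
        have h1 : q ≠ 1 := CharP.char_ne_one k q
        have h2 := (CharP.cast_eq_zero_iff k q p).1 hpk
        obtain rfl := (hp.eq_one_or_self_of_dvd q h2).resolve_left h1
        exact hq
      exact (hasCyclicTower_pow k p m).exists_isSplitTorsor
    · exact exists_isSplitTorsor_of_natCast_ne_zero k _ (by
        rw [Nat.cast_pow]
        exact pow_ne_zero m hpk)
  obtain ⟨β, hβ⟩ := hβ
  let e : H ≃* Multiplicative (ZMod (p ^ m)) :=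
    mulEquivOfCyclicCardEq (by rw [hm, Nat.card_congr Multiplicative.toAdd, Nat.card_zmod])
  exact ⟨_, hβ.comp_mulEquiv e⟩

/-! ### The blow-up chart `k[[x,t]] → k(z)[[t]]`, `x ↦ z t` -/

section Blowup

open Polynomial PowerSeries
open scoped RatFunc

variable (k : Type) [Field k]

/-- The exponent of the monomial `x ^ i * t ^ j`. -/
noncomputable def bivariateExponent (ij : ℕ × ℕ) : Fin 2 →₀ ℕ :=
  .single 0 ij.1 + .single 1 ij.2

theorem bivariateExponent_apply_zero (ij : ℕ × ℕ) : bivariateExponent ij 0 = ij.1 := by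
  simp [bivariateExponent]

theorem bivariateExponent_apply_one (ij : ℕ × ℕ) : bivariateExponent ij 1 = ij.2 := by
  simp [bivariateExponent]

theorem bivariateExponent_injective : Function.Injective bivariateExponent := fun a b h =>
  Prod.ext (by rw [← bivariateExponent_apply_zero, h, bivariateExponent_apply_zero])
    (by rw [← bivariateExponent_apply_one, h, bivariateExponent_apply_one])

theorem bivariateExponent_eta (d : Fin 2 →₀ ℕ) : bivariateExponent (d 0, d 1) = d := by
  ext i
  fin_cases i
  · exact bivariateExponent_apply_zero _
  · exact bivariateExponent_apply_one _

theorem hasSubst_blowup : MvPowerSeries.HasSubst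
    (![PowerSeries.C RatFunc.X * PowerSeries.X, PowerSeries.X] :
      Fin 2 → MvPowerSeries Unit (RatFunc k)) := by
  refine MvPowerSeries.hasSubst_of_constantCoeff_zero fun i => ?_
  fin_cases i
  · exact (map_mul (PowerSeries.constantCoeff (R := RatFunc k)) _ _).trans (by simp)
  · exact PowerSeries.constantCoeff_X

/-- The homomorphism `k[[x,t]] → k(z)[[t]]` given by `x ↦ z t` and `t ↦ t`. -/
noncomputable def blowup : MvPowerSeries (Fin 2) k →+* PowerSeries (RatFunc k) :=
  (MvPowerSeries.substAlgHom (R := k) (hasSubst_blowup k)).toRingHom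

variable {k}

theorem coeff_blowup (f : MvPowerSeries (Fin 2) k) (n : ℕ) :
    PowerSeries.coeff n (blowup k f) = algebraMap k[X] (RatFunc k)
      (∑ ij ∈ Finset.HasAntidiagonal.antidiagonal n,
        Polynomial.C (MvPowerSeries.coeff (bivariateExponent ij) f) * Polynomial.X ^ ij.1) := by
  have h1 : PowerSeries.coeff n (blowup k f) = ∑ᶠ d : Fin 2 →₀ ℕ,
      MvPowerSeries.coeff d f • PowerSeries.coeff n (d.prod fun s e =>
        (![PowerSeries.C RatFunc.X * PowerSeries.X, PowerSeries.X] :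
          Fin 2 → PowerSeries (RatFunc k)) s ^ e) := by
    change MvPowerSeries.coeff _ (MvPowerSeries.substAlgHom (R := k) (hasSubst_blowup k) f) = _
    rw [MvPowerSeries.coe_substAlgHom, MvPowerSeries.coeff_subst (hasSubst_blowup k)]
    rfl
  have h2 (ij : ℕ × ℕ) : PowerSeries.coeff n ((bivariateExponent ij).prod fun s e =>
        (![PowerSeries.C RatFunc.X * PowerSeries.X, PowerSeries.X] :
          Fin 2 → PowerSeries (RatFunc k)) s ^ e) =
      if n = ij.1 + ij.2 then RatFunc.X ^ ij.1 else 0 := by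
    rw [Finsupp.prod_fintype _ _ (by simp), Fin.prod_univ_two, bivariateExponent_apply_zero,
      bivariateExponent_apply_one]
    simp only [Matrix.cons_val_zero, Matrix.cons_val_one]
    rw [mul_pow, ← map_pow, mul_assoc, ← pow_add, PowerSeries.coeff_C_mul, PowerSeries.coeff_X_pow,
      mul_ite, mul_one, mul_zero]
  rw [h1, finsum_eq_sum_of_support_subset
    (s := (Finset.HasAntidiagonal.antidiagonal n).map ⟨_, bivariateExponent_injective⟩)]
  · rw [Finset.sum_map, map_sum]
    refine Finset.sum_congr rfl fun ij hij => ?_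
    rw [Function.Embedding.coeFn_mk, h2, if_pos (Finset.HasAntidiagonal.mem_antidiagonal.1 hij).symm,
      map_mul, map_pow, RatFunc.algebraMap_X, RatFunc.algebraMap_C, Algebra.smul_def]
    rfl
  · intro d hd
    rw [← bivariateExponent_eta d] at hd ⊢
    rw [Function.mem_support, h2] at hd
    split_ifs at hd with h
    · simpa [h] using ⟨d 0, d 1, rfl, rfl⟩
    · simp at hd

theorem exists_coeff_blowup (f : MvPowerSeries (Fin 2) k) (n : ℕ) : ∃ q : k[X],
    q.natDegree ≤ n ∧ PowerSeries.coeff n (blowup k f) = algebraMap k[X] (RatFunc k) q := by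
  refine ⟨_, ?_, coeff_blowup f n⟩
  refine natDegree_sum_le_of_forall_le _ _ fun ij hij => ?_
  have h := Finset.HasAntidiagonal.mem_antidiagonal.1 hij
  exact (natDegree_C_mul_X_pow_le _ _).trans (by omega)

theorem exists_blowup_eq (φ : PowerSeries (RatFunc k)) (h : ∀ n, ∃ q : k[X],
    q.natDegree ≤ n ∧ PowerSeries.coeff n φ = algebraMap k[X] (RatFunc k) q) :
    ∃ f, blowup k f = φ := by
  choose q hq hφ using h
  let f : MvPowerSeries (Fin 2) k := fun d => (q (d 0 + d 1)).coeff (d 0)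
  refine ⟨f, ?_⟩
  ext n
  rw [coeff_blowup, hφ]
  congr 1
  conv_rhs => rw [(q n).as_sum_range_C_mul_X_pow' (Nat.lt_succ_of_le (hq n)),
    ← Finset.Nat.sum_antidiagonal_eq_sum_range_succ_mk (n := n)
      (fun ij => Polynomial.C ((q n).coeff ij.1) * Polynomial.X ^ ij.1)]
  refine Finset.sum_congr rfl fun ij hij => ?_
  rw [← Finset.HasAntidiagonal.mem_antidiagonal.1 hij, MvPowerSeries.coeff_apply]
  simp only [f]
  rw [bivariateExponent_apply_zero,
    bivariateExponent_apply_one]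

theorem blowup_injective : Function.Injective (blowup k) := by
  rw [injective_iff_map_eq_zero]
  intro f hf
  ext d
  have h := coeff_blowup f (d 0 + d 1)
  rw [hf, map_zero, eq_comm, map_eq_zero_iff _ (IsFractionRing.injective k[X] (RatFunc k))] at h
  replace h := congrArg (fun p => Polynomial.coeff p (d 0)) h
  simp only [finsetSum_coeff, Polynomial.coeff_C_mul_X_pow, Polynomial.coeff_zero] at h
  rw [Finset.sum_eq_single (d 0, d 1), if_pos rfl, bivariateExponent_eta] at h
  · simpa using h
  · intro ij hij hne
    refine if_neg fun h0 => hne ?_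
    have := Finset.HasAntidiagonal.mem_antidiagonal.1 hij
    ext <;> simp only <;> omega
  · simp

end Blowup

/-! ### Power series with bounded coefficients -/

section BoundedCoefficients

open Polynomial PowerSeries

variable {E : Type} [Field E] {Γ₀ : Type} [LinearOrderedCommGroupWithZero Γ₀]

/-- The power series whose `n`-th coefficient has valuation at most `γ ^ n`. -/
def Valuation.powerSeriesSubring (w : Valuation E Γ₀) (γ : Γ₀) : Subring E⟦X⟧ where
  carrier := {f | ∀ n, w (PowerSeries.coeff n f) ≤ γ ^ n}
  mul_mem' {f g} hf hg n := by
    rw [PowerSeries.coeff_mul]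
    refine w.map_sum_le fun ij hij => ?_
    rw [← Finset.HasAntidiagonal.mem_antidiagonal.1 hij, map_mul, pow_add]
    exact mul_le_mul' (hf _) (hg _)
  one_mem' n := by
    rw [PowerSeries.coeff_one]
    split_ifs with h
    · simp [h]
    · simp
  add_mem' {f g} hf hg n := by
    rw [map_add]
    exact w.map_add_le (hf n) (hg n)
  zero_mem' n := by simp
  neg_mem' {f} hf n := by
    rw [_root_.map_neg, Valuation.map_neg]
    exact hf n

theorem Valuation.mem_powerSeriesSubring {w : Valuation E Γ₀} {γ : Γ₀} {f : E⟦X⟧} :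
    f ∈ w.powerSeriesSubring γ ↔ ∀ n, w (PowerSeries.coeff n f) ≤ γ ^ n :=
  Iff.rfl

/-- Power series over `k` that are independent over `k[X]` stay independent over the power series
over `E` whose coefficients tend to zero for a valuation that is trivial on `k`. -/
theorem PowerSeries.eq_zero_of_coeff_le_pow {k : Type} [Field k] [Algebra k E] (w : Valuation E Γ₀)
    (hw : ∀ a : k, w (algebraMap k E a) ≤ 1) {γ : Γ₀}
    (hγ : ∀ x : E, x ≠ 0 → ∃ N, ∀ n ≥ N, γ ^ n < w x)
    {H : Type} [Fintype H] (β : H → k⟦X⟧)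
    (hβ : ∀ p : H → k[X], ∑ h, (p h : k⟦X⟧) * β h = 0 → ∀ h, p h = 0)
    (p : H → E⟦X⟧) (hp : ∀ h, p h ∈ w.powerSeriesSubring γ)
    (h0 : ∑ h, p h * PowerSeries.map (algebraMap k E) (β h) = 0) (h : H) : p h = 0 := by
  ext n₀
  by_contra hc
  set c := PowerSeries.coeff n₀ (p h) with hc_def
  rw [map_zero] at hc
  obtain ⟨N, hN⟩ := hγ c hc
  let V : Submodule k E :=
    { carrier := {x | w x < 1}
      add_mem' := fun {a b} ha hb => w.map_add_lt ha hb
      zero_mem' := by simp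
      smul_mem' := fun a x hx => by
        rw [Set.mem_ofPred_eq, Algebra.smul_def, map_mul]
        exact (mul_le_of_le_one_left' (hw a)).trans_lt hx }
  have hV : (1 : E) ∉ V := fun h => by
    have h' : w 1 < 1 := h
    simp at h'
  obtain ⟨ℓ, hℓ1, hℓV⟩ := Submodule.exists_le_ker_of_notMem hV
  have hℓ (g : H) (n : ℕ) (hn : N ≤ n) : ℓ (PowerSeries.coeff n (p g) * c⁻¹) = 0 := by
    refine LinearMap.mem_ker.1 (hℓV ?_)
    change w _ < 1
    rw [map_mul, map_inv₀, ← div_eq_mul_inv, div_lt_one₀ (zero_lt_iff.2 (w.ne_zero_iff.2 hc))]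
    exact (hp g n).trans_lt (hN n hn)
  let P (g : H) : k[X] :=
    PowerSeries.trunc N (PowerSeries.mk fun n => ℓ (PowerSeries.coeff n (p g) * c⁻¹))
  have hP (g : H) (n : ℕ) : (P g).coeff n = ℓ (PowerSeries.coeff n (p g) * c⁻¹) := by
    rw [PowerSeries.coeff_trunc, PowerSeries.coeff_mk]
    split_ifs with hn
    · rfl
    · exact (hℓ g n (not_lt.1 hn)).symm
  have hrel : ∑ g, (P g : k⟦X⟧) * β g = 0 := by
    ext m
    have h1 := congrArg (fun x => ℓ (x * c⁻¹)) (congrArg (PowerSeries.coeff m) h0)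
    simp only [map_sum, PowerSeries.coeff_mul, PowerSeries.coeff_map, map_zero, zero_mul,
      Finset.sum_mul] at h1
    simp only [map_sum, PowerSeries.coeff_mul, map_zero, Polynomial.coeff_coe, hP]
    rw [← h1]
    refine Finset.sum_congr rfl fun g _ => Finset.sum_congr rfl fun ij _ => ?_
    rw [mul_right_comm, mul_comm _ (algebraMap k E _), ← Algebra.smul_def, map_smul, smul_eq_mul,
      mul_comm]
  have h2 := hP h n₀
  rw [hβ P hrel h, Polynomial.coeff_zero, ← hc_def, mul_inv_cancel₀ hc] at h2
  exact hℓ1 h2.symm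

end BoundedCoefficients

/-! ### Places of `k(z)` and principal parts -/

section Places

open Polynomial IsDedekindDomain WithZero
open scoped RatFunc

variable {k : Type} [Field k]

instance (k : Type) [Field k] : Infinite (HeightOneSpectrum k[X]) := by
  refine ⟨fun hfin => ?_⟩
  have := Fintype.ofFinite (HeightOneSpectrum k[X])
  let g (v : HeightOneSpectrum k[X]) : k[X] := Submodule.IsPrincipal.generator v.asIdeal
  have hg (v) : g v ∈ v.asIdeal := Submodule.IsPrincipal.generator_mem _
  have hg0 (v) : g v ≠ 0 := fun h =>
    v.ne_bot ((Submodule.IsPrincipal.eq_bot_iff_generator_eq_zero _).2 h)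
  have hP : ∏ v, g v ≠ 0 := Finset.prod_ne_zero_iff.2 fun v _ => hg0 v
  have hdeg : 0 < (X * ∏ v, g v).natDegree := by
    rw [natDegree_X_mul hP]
    exact Nat.succ_pos _
  have hdeg' : 0 < (X * ∏ v, g v + 1).natDegree := by
    rwa [← C_1, natDegree_add_C]
  have hunit : ¬IsUnit (X * ∏ v, g v + 1) := fun h =>
    hdeg'.ne' (natDegree_eq_zero_of_isUnit h)
  obtain ⟨M, hM, hfM⟩ := exists_max_ideal_of_mem_nonunits hunit
  let v : HeightOneSpectrum k[X] := ⟨M, hM.isPrime, fun h => by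
    rw [h, Ideal.mem_bot] at hfM
    rw [hfM, natDegree_zero] at hdeg'
    exact lt_irrefl _ hdeg'⟩
  refine hM.ne_top ((Ideal.eq_top_iff_one M).2 ?_)
  have h : X * ∏ v, g v ∈ M :=
    M.mul_mem_left _ (Ideal.mem_of_dvd M (Finset.dvd_prod_of_mem g (Finset.mem_univ v)) (hg v))
  simpa using M.sub_mem hfM h

theorem IsDedekindDomain.HeightOneSpectrum.valuation_generator_of_ne
    {v w : HeightOneSpectrum k[X]} {π : k[X]} (hπ : v.asIdeal = Ideal.span {π}) (hw : w ≠ v) :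
    w.valuation (RatFunc k) (algebraMap k[X] (RatFunc k) π) = 1 := by
  rw [HeightOneSpectrum.valuation_eq_one_iff_notMem]
  intro h
  refine hw (HeightOneSpectrum.ext ?_).symm
  refine v.isMaximal.eq_of_le w.isPrime.ne_top ?_
  rwa [hπ, Ideal.span_singleton_le_iff_mem]

theorem IsDedekindDomain.HeightOneSpectrum.valuation_generator
    {v : HeightOneSpectrum k[X]} {π : k[X]} (hπ : v.asIdeal = Ideal.span {π}) :
    v.valuation (RatFunc k) (algebraMap k[X] (RatFunc k) π) = exp (-1) := by
  rw [HeightOneSpectrum.valuation_of_algebraMap]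
  refine v.intValuation_singleton ?_ hπ
  rintro rfl
  exact v.ne_bot (by simpa using hπ)

variable [DecidableEq (RatFunc k)]

theorem RatFunc.inftyValuation_polynomial_le (p : k[X]) :
    RatFunc.inftyValuation k (algebraMap k[X] (RatFunc k) p) ≤ exp (p.natDegree : ℤ) := by
  obtain rfl | hp := eq_or_ne p 0
  · simp
  · exact (RatFunc.inftyValuation.polynomial k hp).le

theorem RatFunc.inftyValuation_inv_polynomial_le_one (p : k[X]) :
    RatFunc.inftyValuation k (algebraMap k[X] (RatFunc k) p)⁻¹ ≤ 1 := by
  obtain rfl | hp := eq_or_ne p 0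
  · simp
  · have h : RatFunc.inftyValuation k (algebraMap k[X] (RatFunc k) p) = exp (p.natDegree : ℤ) :=
      RatFunc.inftyValuation.polynomial k hp
    rw [map_inv₀, h, ← exp_neg, ← exp_zero, exp_le_exp]
    simp

theorem RatFunc.exists_principalPart {v : HeightOneSpectrum k[X]} {π : k[X]}
    (hπ : v.asIdeal = Ideal.span {π}) (u : RatFunc k) : ∃ s : RatFunc k,
      (∀ w ≠ v, w.valuation (RatFunc k) s ≤ 1) ∧ RatFunc.inftyValuation k s ≤ 1 ∧
      v.valuation (RatFunc k) (s - u) ≤ 1 := by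
  let a := algebraMap k[X] (RatFunc k)
  have hπ0 : π ≠ 0 := by
    rintro rfl
    exact v.ne_bot (by simpa using hπ)
  have haπ : a π ≠ 0 := by simpa [a] using hπ0
  obtain ⟨j, hj⟩ : ∃ j : ℕ, v.valuation (RatFunc k) (a π ^ j * u) ≤ 1 := by
    obtain rfl | hu := eq_or_ne u 0
    · exact ⟨0, by simp⟩
    · refine ⟨(log (v.valuation (RatFunc k) u)).toNat, ?_⟩
      rw [map_mul, map_pow, HeightOneSpectrum.valuation_generator hπ,
        ← exp_log ((v.valuation (RatFunc k)).ne_zero_iff.2 hu), ← exp_nsmul, ← exp_add,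
        ← exp_zero, exp_le_exp]
      have := Int.self_le_toNat (log (v.valuation (RatFunc k) u))
      simp only [log_exp, nsmul_eq_mul]
      linarith
  have hvπ : v.valuation (RatFunc k) (a π ^ j) ≠ 0 :=
    (v.valuation (RatFunc k)).ne_zero_iff.2 (pow_ne_zero j haπ)
  obtain ⟨b, hb⟩ := v.exists_valuation_sub_lt_of_integer hj (Units.mk0 _ hvπ)
  rw [Units.val_mk0] at hb
  have hmod : a b = a (π ^ j) * a (b / π ^ j) + a (b % π ^ j) := by
    rw [← map_mul, ← map_add, EuclideanDomain.div_add_mod]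
  refine ⟨a (b % π ^ j) / a π ^ j, fun w hw => ?_, ?_, ?_⟩
  · rw [map_div₀, map_pow, HeightOneSpectrum.valuation_generator_of_ne hπ hw, one_pow, div_one]
    exact w.valuation_le_one _
  · obtain h0 | h0 := eq_or_ne (b % π ^ j) 0
    · simp [h0]
    have h1 : RatFunc.inftyValuation k (a (b % π ^ j)) = exp ((b % π ^ j).natDegree : ℤ) :=
      RatFunc.inftyValuation.polynomial k h0
    have h2 : RatFunc.inftyValuation k (a (π ^ j)) = exp ((π ^ j).natDegree : ℤ) :=
      RatFunc.inftyValuation.polynomial k (pow_ne_zero j hπ0)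
    rw [← map_pow, map_div₀, h1, h2, ← exp_sub, ← exp_zero, exp_le_exp, sub_nonpos, Nat.cast_le]
    exact natDegree_le_natDegree (EuclideanDomain.mod_lt b (pow_ne_zero j hπ0)).le
  · have h : a (b % π ^ j) / a π ^ j - u
        = (a b - a π ^ j * u) / a π ^ j - a (b / π ^ j) := by
      rw [hmod, map_pow]
      field_simp
      ring
    rw [h]
    refine (Valuation.map_sub _ _ _).trans (max_le ?_ (v.valuation_le_one _))
    rw [map_div₀]
    exact (div_le_one₀ (zero_lt_iff.2 hvπ)).2 hb.le

end Places

/-! ### Solving the patching problem coefficient by coefficient -/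

section Recursion

open PowerSeries

theorem exists_strongRec {X : Type} (F : (N : ℕ) → ((m : ℕ) → m < N → X) → X) :
    ∃ Q : ℕ → X, ∀ N, Q N = F N fun m _ => Q m :=
  ⟨Nat.lt_wfRel.wf.fix F, fun N => WellFounded.fix_eq _ F N⟩

theorem PowerSeries.exists_patching_solution {E G ι : Type} [Field E] [Group G] [Finite ι]
    (H : ι → Subgroup G) [∀ i, Fintype (H i)] (B : ∀ i, H i → E⟦X⟧)
    (hB1 : ∀ i, constantCoeff (B i 1) = 1) (hB0 : ∀ i, ∀ h ≠ 1, constantCoeff (B i h) = 0)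
    (D : Subring E) (O : ι → Subring E) (hBD : ∀ i h n, PowerSeries.coeff n (B i h) ∈ D)
    (hpp : ∀ i u, ∃ s ∈ D, (∀ j ≠ i, s ∈ O j) ∧ s - u ∈ O i) :
    ∃ (v : G → E⟦X⟧) (q : ι → G → E⟦X⟧),
      (∀ i θ, v θ = ∑ h : H i, q i (θ * (h : G)⁻¹) * B i h) ∧
      (∀ θ ≠ 1, v θ ≠ v 1) ∧ ∀ i θ n, PowerSeries.coeff n (q i θ) ∈ D ⊓ O i := by
  classical
  have := Fintype.ofFinite ι
  choose pp hppD hppj hppi using hpp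
  let U (N : ℕ) (Q : (m : ℕ) → m < N → ι → G → E) (i : ι) (θ : G) : E :=
    ∑ h : H i, ∑ m : Fin N, Q m m.2 i (θ * (h : G)⁻¹) * PowerSeries.coeff (N - m) (B i h)
  let W (N : ℕ) (Q : (m : ℕ) → m < N → ι → G → E) (θ : G) : E :=
    if N = 0 then (if θ = 1 then 1 else 0) else ∑ i, pp i (U N Q i θ)
  obtain ⟨Q, hQ⟩ := exists_strongRec (X := ι → G → E) fun N Q i θ => W N Q θ - U N Q i θ
  let Q' (N m : ℕ) (_ : m < N) : ι → G → E := Q m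
  replace hQ (N : ℕ) (i : ι) (θ : G) : Q N i θ = W N (Q' N) θ - U N (Q' N) i θ := by
    conv_lhs => rw [hQ]
  have hmem (N : ℕ) : ∀ i θ, Q N i θ ∈ D ⊓ O i := by
    induction N using Nat.strong_induction_on with
    | _ N ih =>
      intro i θ
      have hU (i θ) : U N (Q' N) i θ ∈ D :=
        sum_mem fun h _ => sum_mem fun m _ => mul_mem (ih m m.2 i _).1 (hBD i h _)
      rw [hQ]
      by_cases hN : N = 0
      · subst hN
        have h1 : U 0 (Q' 0) i θ = 0 := by simp [U]
        simp only [W, if_pos, h1, sub_zero]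
        split_ifs
        · exact one_mem _
        · exact zero_mem _
      · simp only [W, if_neg hN]
        refine ⟨sub_mem (sum_mem fun j _ => hppD j _) (hU i θ), ?_⟩
        rw [← Finset.add_sum_erase _ _ (Finset.mem_univ i), add_sub_right_comm]
        exact add_mem (hppi i _) (sum_mem fun j hj => hppj j _ i (Finset.ne_of_mem_erase hj).symm)
  refine ⟨fun θ => .mk fun N => W N (Q' N) θ, fun i θ => .mk fun N => Q N i θ, fun i θ => ?_,
    fun θ hθ h => ?_, fun i θ n => ?_⟩
  · ext N
    rw [PowerSeries.coeff_mk, map_sum]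
    have h1 (h : H i) : PowerSeries.coeff N
        ((PowerSeries.mk fun N => Q N i (θ * (h : G)⁻¹)) * B i h) =
        (∑ m : Fin N, Q m i (θ * (h : G)⁻¹) * PowerSeries.coeff (N - m) (B i h)) +
          if h = 1 then Q N i θ else 0 := by
      rw [PowerSeries.coeff_mul, Finset.Nat.sum_antidiagonal_eq_sum_range_succ_mk,
        Finset.sum_range_succ, Finset.sum_range]
      simp only [PowerSeries.coeff_mk, Nat.sub_self, PowerSeries.coeff_zero_eq_constantCoeff_apply]
      congr 1
      split_ifs with h1
      · subst h1
        simp [hB1]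
      · rw [hB0 i h h1, mul_zero]
    simp_rw [h1]
    rw [Finset.sum_add_distrib, Finset.sum_ite_eq', if_pos (Finset.mem_univ _), hQ]
    exact (add_sub_cancel _ _).symm
  · have h0 := congrArg (PowerSeries.coeff 0) h
    simp [W, hθ] at h0
  · rw [PowerSeries.coeff_mk]
    exact hmem n i θ

end Recursion

/-! ### Patching split torsors over `k((x,t))` -/

section TwoVarPatching

open Polynomial PowerSeries IsDedekindDomain WithZero
open scoped RatFunc

variable {k : Type} [Field k]

/-- The homomorphism `k[[X]] → k(z)[[t]]` sending `X` to `t / π`. -/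
noncomputable def rescaledBaseChange (π : k[X]) : k⟦X⟧ →+* (RatFunc k)⟦X⟧ :=
  (PowerSeries.rescale (algebraMap k[X] (RatFunc k) π)⁻¹).comp
    (PowerSeries.map (algebraMap k (RatFunc k)))

theorem coeff_rescaledBaseChange (π : k[X]) (f : k⟦X⟧) (n : ℕ) :
    PowerSeries.coeff n (rescaledBaseChange π f) =
      (algebraMap k[X] (RatFunc k) π)⁻¹ ^ n * algebraMap k (RatFunc k) (PowerSeries.coeff n f) := by
  simp [rescaledBaseChange, PowerSeries.coeff_rescale]

theorem rescale_rescaledBaseChange {π : k[X]} (hπ : π ≠ 0) (f : k⟦X⟧) :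
    PowerSeries.rescale (algebraMap k[X] (RatFunc k) π) (rescaledBaseChange π f) =
      PowerSeries.map (algebraMap k (RatFunc k)) f := by
  have h : algebraMap k[X] (RatFunc k) π ≠ 0 := by simpa using hπ
  ext n
  rw [PowerSeries.coeff_rescale, coeff_rescaledBaseChange, ← mul_assoc, ← mul_pow,
    mul_inv_cancel₀ h, one_pow, one_mul, PowerSeries.coeff_map]

theorem rescaledBaseChange_injective {π : k[X]} (hπ : π ≠ 0) :
    Function.Injective (rescaledBaseChange π) := fun f g h =>
  PowerSeries.map_injective _ (algebraMap k (RatFunc k)).injective (by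
    rw [← rescale_rescaledBaseChange hπ, h, rescale_rescaledBaseChange hπ])

theorem exists_blowup_mul_rescaledBaseChange {π : k[X]} (hπ : π ≠ 0) (p : k[X]) :
    ∃ r s : MvPowerSeries (Fin 2) k, s ≠ 0 ∧
      blowup k s * rescaledBaseChange π (p : k⟦X⟧) = blowup k r := by
  have haπ : algebraMap k[X] (RatFunc k) π ≠ 0 := by simpa using hπ
  obtain ⟨s₁, hs₁⟩ := exists_blowup_eq (k := k)
    (PowerSeries.monomial π.natDegree (algebraMap k[X] (RatFunc k) π)) fun n => by
      rw [PowerSeries.coeff_monomial]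
      split_ifs with h
      · exact ⟨π, h.ge, rfl⟩
      · exact ⟨0, by simp⟩
  obtain ⟨r₁, hr₁⟩ := exists_blowup_eq (k := k)
    (PowerSeries.monomial (π.natDegree + 1) 1) fun n => by
      rw [PowerSeries.coeff_monomial]
      split_ifs with h
      · exact ⟨1, by simp⟩
      · exact ⟨0, by simp⟩
  have hs₁0 : s₁ ≠ 0 := by
    rintro rfl
    rw [map_zero] at hs₁
    have h := congrArg (PowerSeries.coeff π.natDegree) hs₁
    rw [PowerSeries.coeff_monomial_same, map_zero] at h
    exact haπ h.symm
  have hC (a : k) : ∃ r, blowup k r = rescaledBaseChange π ((Polynomial.C a : k[X]) : k⟦X⟧) := by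
    refine exists_blowup_eq _ fun n => ?_
    rw [coeff_rescaledBaseChange, Polynomial.coe_C, PowerSeries.coeff_C]
    split_ifs with h
    · exact ⟨Polynomial.C a, by simp, by simp [h, RatFunc.algebraMap_C]⟩
    · exact ⟨0, by simp⟩
  have hX : blowup k s₁ * rescaledBaseChange π PowerSeries.X = blowup k r₁ := by
    have h : rescaledBaseChange π PowerSeries.X
        = PowerSeries.monomial 1 (algebraMap k[X] (RatFunc k) π)⁻¹ := by
      ext n
      rw [coeff_rescaledBaseChange, PowerSeries.coeff_X, PowerSeries.coeff_monomial]
      split_ifs with h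
      · simp [h]
      · simp
    rw [hs₁, hr₁, h, PowerSeries.monomial_mul_monomial, mul_inv_cancel₀ haπ]
  induction p using Polynomial.induction_on' with
  | add p q hp hq =>
    obtain ⟨r, s, hs, h⟩ := hp
    obtain ⟨r', s', hs', h'⟩ := hq
    refine ⟨r * s' + r' * s, s * s', mul_ne_zero hs hs', ?_⟩
    rw [Polynomial.coe_add, map_add, map_add, map_mul, map_mul, map_mul, ← h, ← h']
    ring
  | monomial n a =>
    obtain ⟨r, hr⟩ := hC a
    refine ⟨r * r₁ ^ n, s₁ ^ n, pow_ne_zero n hs₁0, ?_⟩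
    rw [← Polynomial.C_mul_X_pow_eq_monomial, Polynomial.coe_mul, Polynomial.coe_pow,
      Polynomial.coe_X, map_mul, ← hr, map_pow, map_pow, map_mul, map_pow, ← hX]
    ring

end TwoVarPatching

/-! ### Gluing split torsors with different groups -/

section Gluing

open Polynomial PowerSeries IsDedekindDomain WithZero
open scoped RatFunc

variable {k : Type} [Field k]

/-- The structure of a `k[[x,t]]`-algebra on `k(z)[[t]]` given by the blow-up chart. -/
noncomputable abbrev blowupAlgebra (k : Type) [Field k] :
    Algebra (MvPowerSeries (Fin 2) k) (PowerSeries (RatFunc k)) :=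
  (blowup k).toAlgebra

attribute [local instance] blowupAlgebra FractionRing.liftAlgebra

theorem valuation_algebraMap_le_one (w : HeightOneSpectrum k[X]) (a : k) :
    w.valuation (RatFunc k) (algebraMap k (RatFunc k) a) ≤ 1 := by
  rw [IsScalarTower.algebraMap_apply k k[X] (RatFunc k)]
  exact w.valuation_le_one _

theorem Valuation.map_pow_mul_le_one {E Γ₀ : Type} [Field E]
    [LinearOrderedCommGroupWithZero Γ₀] (w : Valuation E Γ₀) {a b : E} (ha : w a ≤ 1)
    (hb : w b ≤ 1) (n : ℕ) : w (a ^ n * b) ≤ 1 := by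
  rw [_root_.map_mul, _root_.map_pow]
  exact mul_le_one' (pow_le_one' ha n) hb

variable {ι : Type} (v : ι → HeightOneSpectrum k[X])

open scoped Classical in
/-- The rational functions that are regular away from finitely many given places. -/
noncomputable def regularAwayFrom : Subring (RatFunc k) :=
  (RatFunc.inftyValuation k).integer ⊓
    ⨅ w : {w // w ∉ Set.range v}, (w.1.valuation (RatFunc k)).integer

open scoped Classical in
theorem mem_regularAwayFrom {x : RatFunc k} : x ∈ regularAwayFrom v ↔
    RatFunc.inftyValuation k x ≤ 1 ∧ ∀ w ∉ Set.range v, w.valuation (RatFunc k) x ≤ 1 := by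
  simp [regularAwayFrom, Subring.mem_iInf, Valuation.mem_integer_iff]

open scoped Classical in
/-- The ring of power series over `k(z)` regular on the part of the blow-up that avoids all of the
given places except `v i`. -/
noncomputable def chartSubalgebra (i : ι) :
    Subalgebra (MvPowerSeries (Fin 2) k) (PowerSeries (RatFunc k)) where
  __ := ((RatFunc.inftyValuation k).powerSeriesSubring (exp 1) ⊓
    ((v i).valuation (RatFunc k)).powerSeriesSubring 1 ⊓
    ⨅ w : {w // w ∉ Set.range v}, (w.1.valuation (RatFunc k)).powerSeriesSubring 1).toSubsemiring
  algebraMap_mem' f := by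
    simp only [Subsemiring.coe_carrier_toSubmonoid, Subring.coe_toSubsemiring, SetLike.mem_coe,
      Subring.mem_inf, Subring.mem_iInf, Valuation.mem_powerSeriesSubring]
    have h (w : HeightOneSpectrum k[X]) (n : ℕ) : w.valuation (RatFunc k)
        (PowerSeries.coeff n (blowup k f)) ≤ 1 ^ n := by
      obtain ⟨q, -, hq⟩ := exists_coeff_blowup f n
      rw [hq, one_pow]
      exact w.valuation_le_one q
    refine ⟨⟨fun n => ?_, h _⟩, fun w => h w⟩
    obtain ⟨q, hqn, hq⟩ := exists_coeff_blowup f n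
    refine (congrArg _ hq).trans_le ((RatFunc.inftyValuation_polynomial_le q).trans ?_)
    rw [← exp_nsmul, exp_le_exp]
    simpa using hqn

open scoped Classical in
theorem mem_chartSubalgebra {i : ι} {f : PowerSeries (RatFunc k)} : f ∈ chartSubalgebra v i ↔
    (∀ n, RatFunc.inftyValuation k (PowerSeries.coeff n f) ≤ exp 1 ^ n) ∧
    (∀ n, (v i).valuation (RatFunc k) (PowerSeries.coeff n f) ≤ 1) ∧
    ∀ w ∉ Set.range v, ∀ n, w.valuation (RatFunc k) (PowerSeries.coeff n f) ≤ 1 := by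
  change f ∈ ((RatFunc.inftyValuation k).powerSeriesSubring (exp 1) ⊓
    ((v i).valuation (RatFunc k)).powerSeriesSubring 1 ⊓
    ⨅ w : {w // w ∉ Set.range v}, (w.1.valuation (RatFunc k)).powerSeriesSubring 1) ↔ _
  simp [Subring.mem_inf, Subring.mem_iInf, Valuation.mem_powerSeriesSubring, and_assoc]

theorem iInf_chartSubalgebra [Nonempty ι] : ⨅ i, chartSubalgebra v i = ⊥ := by
  classical
  refine eq_bot_iff.2 fun f hf => ?_
  rw [Algebra.mem_iInf] at hf
  simp only [mem_chartSubalgebra] at hf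
  obtain ⟨g, hg⟩ := exists_blowup_eq f fun n => by
    obtain ⟨q, hq⟩ := HeightOneSpectrum.mem_integers_of_valuation_le_one (R := k[X]) (RatFunc k)
        (PowerSeries.coeff n f) fun w => by
      by_cases hw : w ∈ Set.range v
      · obtain ⟨i, rfl⟩ := hw
        exact (hf i).2.1 n
      · exact (hf (Classical.arbitrary ι)).2.2 w hw n
    refine ⟨q, ?_, hq.symm⟩
    obtain rfl | hq0 := eq_or_ne q 0
    · simp
    have h := (hf (Classical.arbitrary ι)).1 n
    have h1 : RatFunc.inftyValuation k (algebraMap k[X] (RatFunc k) q) = exp (q.natDegree : ℤ) :=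
      RatFunc.inftyValuation.polynomial k hq0
    rw [← hq, h1, ← exp_nsmul, exp_le_exp] at h
    simpa using h
  exact Algebra.mem_bot.2 ⟨g, hg⟩

theorem coeff_rescaledBaseChange_mem_regularAwayFrom {π : k[X]} {i : ι}
    (hπ : (v i).asIdeal = Ideal.span {π}) (f : k⟦X⟧) (n : ℕ) :
    PowerSeries.coeff n (rescaledBaseChange π f) ∈ regularAwayFrom v := by
  classical
  rw [mem_regularAwayFrom, coeff_rescaledBaseChange]
  refine ⟨Valuation.map_pow_mul_le_one _ (RatFunc.inftyValuation_inv_polynomial_le_one π) ?_ n,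
    fun w hw => Valuation.map_pow_mul_le_one _ ?_ (valuation_algebraMap_le_one w _) n⟩
  · rw [IsScalarTower.algebraMap_apply k k[X] (RatFunc k)]
    refine (RatFunc.inftyValuation_polynomial_le _).trans_eq ?_
    simp
  · rw [map_inv₀, HeightOneSpectrum.valuation_generator_of_ne hπ fun h => hw ⟨i, h.symm⟩, inv_one]

theorem IsSplitTorsor.eq_zero_of_mem_chartSubalgebra {H : Type} [Group H] [Fintype H]
    {β : H → k⟦X⟧} (hβ : IsSplitTorsor β) {π : k[X]} {i : ι}
    (hπ : (v i).asIdeal = Ideal.span {π}) (p : H → (RatFunc k)⟦X⟧)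
    (hp : ∀ h, p h ∈ chartSubalgebra v i)
    (h0 : ∑ h, p h * rescaledBaseChange π (β h) = 0) (h : H) : p h = 0 := by
  have hπ0 : π ≠ 0 := by
    rintro rfl
    exact (v i).ne_bot (by simpa using hπ)
  have haπ : algebraMap k[X] (RatFunc k) π ≠ 0 := by simpa using hπ0
  suffices PowerSeries.rescale (algebraMap k[X] (RatFunc k) π) (p h) = 0 by
    ext n
    have h1 := congrArg (PowerSeries.coeff n) this
    rw [PowerSeries.coeff_rescale, map_zero] at h1
    simpa [haπ] using h1
  refine PowerSeries.eq_zero_of_coeff_le_pow ((v i).valuation (RatFunc k))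
    (valuation_algebraMap_le_one _) (γ := exp (-1)) (fun x hx => ?_) β hβ.indep
    (fun h => PowerSeries.rescale (algebraMap k[X] (RatFunc k) π) (p h)) (fun h n => ?_) ?_ h
  · have hx' := ((v i).valuation (RatFunc k)).ne_zero_iff.2 hx
    refine ⟨(1 - log ((v i).valuation (RatFunc k) x)).toNat, fun n hn => ?_⟩
    rw [← exp_log hx', ← exp_nsmul, exp_lt_exp]
    simp only [nsmul_eq_mul]
    omega
  · rw [PowerSeries.coeff_rescale, map_mul, map_pow, HeightOneSpectrum.valuation_generator hπ]
    exact mul_le_of_le_one_right' (((mem_chartSubalgebra v).1 (hp h)).2.1 n)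
  · have h1 := congrArg (PowerSeries.rescale (algebraMap k[X] (RatFunc k) π)) h0
    simpa only [map_sum, map_mul, map_zero, rescale_rescaledBaseChange hπ0] using h1

instance : FaithfulSMul (MvPowerSeries (Fin 2) k) (FractionRing (PowerSeries (RatFunc k))) := by
  rw [faithfulSMul_iff_algebraMap_injective]
  exact (IsFractionRing.injective (PowerSeries (RatFunc k))
    (FractionRing (PowerSeries (RatFunc k)))).comp blowup_injective

theorem exists_algebraMap_eq_rescaledBaseChange {π : k[X]} (hπ : π ≠ 0) (p : k[X]) :
    ∃ κ : TwoVarLocalField k, algebraMap _ (FractionRing (PowerSeries (RatFunc k))) κ =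
      algebraMap _ _ (rescaledBaseChange π (p : k⟦X⟧)) := by
  obtain ⟨r, s, hs, h⟩ := exists_blowup_mul_rescaledBaseChange hπ p
  have hs' : algebraMap (MvPowerSeries (Fin 2) k) (FractionRing (PowerSeries (RatFunc k))) s ≠ 0 :=
    algebraMap_ne_zero_of_fractionRing (TwoVarLocalField k) hs
  refine ⟨algebraMap _ _ r / algebraMap _ _ s, ?_⟩
  rw [map_div₀, ← IsScalarTower.algebraMap_apply, ← IsScalarTower.algebraMap_apply,
    div_eq_iff hs', IsScalarTower.algebraMap_apply _ (PowerSeries (RatFunc k)) _ r,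
    IsScalarTower.algebraMap_apply _ (PowerSeries (RatFunc k)) _ s, ← map_mul, mul_comm]
  exact congrArg _ h.symm

theorem exists_isGaloisGroup_of_isSplitTorsor {G : Type} [Group G] [Finite G] [Finite ι]
    [Nonempty ι] (H : ι → Subgroup G) [∀ i, Fintype (H i)] (hH : ⨆ i, H i = ⊤)
    (β : ∀ i, H i → k⟦X⟧) (hβ : ∀ i, IsSplitTorsor (β i)) :
    ∃ (F : Type) (_ : Field F) (_ : Algebra (TwoVarLocalField k) F) (_ : MulSemiringAction G F),
      IsGaloisGroup G (TwoVarLocalField k) F := by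
  classical
  obtain ⟨n, ⟨e⟩⟩ := Finite.exists_equiv_fin ι
  let v (i : ι) : HeightOneSpectrum k[X] := Infinite.natEmbedding _ (e i : ℕ)
  have hv : Function.Injective v := fun i j h =>
    e.injective (Fin.ext ((Infinite.natEmbedding _).injective h))
  let π (i : ι) : k[X] := Submodule.IsPrincipal.generator (v i).asIdeal
  have hπ (i : ι) : (v i).asIdeal = Ideal.span {π i} :=
    ((v i).asIdeal.span_singleton_generator).symm
  have hπ0 (i : ι) : π i ≠ 0 := fun h => (v i).ne_bot (by simpa [h] using hπ i)
  obtain ⟨V, q, hV, hV1, hq⟩ := PowerSeries.exists_patching_solution H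
    (fun i h => rescaledBaseChange (π i) (β i h))
    (fun i => by
      rw [← PowerSeries.coeff_zero_eq_constantCoeff_apply, coeff_rescaledBaseChange,
        PowerSeries.coeff_zero_eq_constantCoeff_apply, (hβ i).one]
      simp)
    (fun i h hh => by
      rw [← PowerSeries.coeff_zero_eq_constantCoeff_apply, coeff_rescaledBaseChange,
        PowerSeries.coeff_zero_eq_constantCoeff_apply, (hβ i).ne h hh]
      simp)
    (regularAwayFrom v) (fun i => ((v i).valuation (RatFunc k)).integer)
    (fun i h n => coeff_rescaledBaseChange_mem_regularAwayFrom v (hπ i) _ n)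
    (fun i u => by
      obtain ⟨s, h1, h2, h3⟩ := RatFunc.exists_principalPart (hπ i) u
      exact ⟨s, (mem_regularAwayFrom v).2 ⟨h2, fun w hw => h1 w fun h => hw ⟨i, h.symm⟩⟩,
        fun j hj => h1 _ (hv.ne hj), h3⟩)
  have hκ (i : ι) := exists_algebraMap_eq_rescaledBaseChange (hπ0 i)
  choose κ hκ using hκ
  have hκ0 (i : ι) {d : k[X]} (hd : d ≠ 0) : κ i d ≠ 0 := by
    intro h
    have h1 := hκ i d
    rw [h, map_zero, eq_comm, map_eq_zero_iff _ (IsFractionRing.injective _ _),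
      map_eq_zero_iff _ (rescaledBaseChange_injective (hπ0 i))] at h1
    exact hd (by simpa using h1)
  refine exists_isGaloisGroup_of_fractions (R := MvPowerSeries (Fin 2) k)
    (Q := PowerSeries (RatFunc k)) (Ω := FractionRing (PowerSeries (RatFunc k)))
    H hH (chartSubalgebra v) (iInf_chartSubalgebra v)
    (fun i h => rescaledBaseChange (π i) (β i h))
    (fun i p hp h0 => (hβ i).eq_zero_of_mem_chartSubalgebra v (hπ i) p hp h0)
    (fun i => ?_) (fun i => ?_) V q (fun i θ => ?_) hV hV1
  · obtain ⟨d, hd, c, hc⟩ := (hβ i).mul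
    refine ⟨fun a b h => κ i (c a b h) / κ i d, fun a b τ => ?_⟩
    have hd' : algebraMap (TwoVarLocalField k) (FractionRing (PowerSeries (RatFunc k)))
        (κ i d) ≠ 0 := by simpa using hκ0 i hd
    refine mul_left_cancel₀ hd' ?_
    have h1 := congrArg (fun f => algebraMap _ (FractionRing (PowerSeries (RatFunc k)))
      (rescaledBaseChange (π i) f)) (hc a b τ)
    simp only [map_mul, map_sum, ← hκ] at h1
    rw [h1, Finset.mul_sum]
    refine Finset.sum_congr rfl fun h _ => ?_
    rw [Algebra.smul_def, ← mul_assoc, ← map_mul, mul_div_cancel₀ _ (hκ0 i hd)]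
  · obtain ⟨d, e, hd, he⟩ := (hβ i).sum
    refine ⟨κ i e / κ i d, ?_⟩
    have hd' : algebraMap (TwoVarLocalField k) (FractionRing (PowerSeries (RatFunc k)))
        (κ i d) ≠ 0 := by simpa using hκ0 i hd
    have h1 := congrArg (fun f => algebraMap _ (FractionRing (PowerSeries (RatFunc k)))
      (rescaledBaseChange (π i) f)) he
    simp only [map_mul, map_sum, ← hκ] at h1
    rw [Algebra.smul_def, map_div₀, div_mul_eq_mul_div, h1, div_self hd']
  · refine (mem_chartSubalgebra v).2 ⟨fun n => ?_, fun n => (hq i θ n).2,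
      fun w hw n => ((mem_regularAwayFrom v).1 (hq i θ n).1).2 w hw⟩
    refine ((mem_regularAwayFrom v).1 (hq i θ n).1).1.trans (one_le_pow_of_one_le' ?_ n)
    rw [← exp_zero, exp_le_exp]
    exact zero_le_one

end Gluing

theorem Subgroup.iSup_zpowers_primePow_eq_top (Γ : Type) [Group Γ] [Finite Γ] :
    ⨆ g : {g : Γ // ∃ p m : ℕ, p.Prime ∧ orderOf g = p ^ m}, Subgroup.zpowers g.1 = ⊤ := by
  refine Subgroup.eq_top_of_card_eq _ (Nat.dvd_antisymm (Subgroup.card_subgroup_dvd_card _) ?_)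
  refine (Nat.dvd_iff_prime_pow_dvd_dvd _ _).2 fun p n hp hpn => ?_
  have := Fact.mk hp
  obtain ⟨K, hK⟩ := Sylow.exists_subgroup_card_pow_prime p hpn
  rw [← hK]
  refine Subgroup.card_dvd_of_le fun g hg => ?_
  obtain ⟨m, -, hm⟩ := (Nat.dvd_prime_pow hp).1 (hK ▸ K.orderOf_dvd_natCard hg)
  exact Subgroup.mem_iSup_of_mem ⟨g, p, m, hp, hm⟩ (Subgroup.mem_zpowers g)

/-- Every finite group is a Galois group over `K = k((x,t))`: for every field `k` and every
finite group `Γ` there is a finite Galois field extension `M` of `K` (realized inside an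
algebraic closure of `K`) whose Galois group is isomorphic to `Γ`. -/
theorem exists_galoisExtension_of_twoVarLocalField (k : Type) [Field k]
    (Γ : Type) [Group Γ] [Finite Γ] :
    ∃ M : IntermediateField (TwoVarLocalField k) (AlgebraicClosure (TwoVarLocalField k)),
      FiniteDimensional (TwoVarLocalField k) M ∧ IsGalois (TwoVarLocalField k) M ∧
      Nonempty ((M ≃ₐ[TwoVarLocalField k] M) ≃* Γ) := by
  classical
  let ι := {g : Γ // ∃ p m : ℕ, p.Prime ∧ orderOf g = p ^ m}
  have : Nonempty ι := ⟨⟨1, 2, 0, Nat.prime_two, by simp⟩⟩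
  let H (g : ι) : Subgroup Γ := Subgroup.zpowers g.1
  have (g : ι) : Fintype (H g) := Fintype.ofFinite _
  have hβ (g : ι) : ∃ β : H g → PowerSeries k, IsSplitTorsor β := by
    obtain ⟨p, m, hp, hm⟩ := g.2
    exact exists_isSplitTorsor_of_isCyclic k (H g) ⟨p, m, hp, by rw [Nat.card_zpowers, hm]⟩
  choose β hβ using hβ
  obtain ⟨F, _, _, _, _⟩ := exists_isGaloisGroup_of_isSplitTorsor H
    (Subgroup.iSup_zpowers_primePow_eq_top Γ) β hβ
  exact exists_intermediateField_of_isGaloisGroup (F := F)
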